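/- Case 2 of Theorem 1.2: the hypergeometric group Γ(f,g) generated by the companion matrices A and B of f(x) = x^5 - 2x^4 + x^3 - x^2 + 2x - 1 and g(x) = x^5 + x^3 + x^2 + 1 is an arithmetic subgroup of the integral orthogonal group O_Q(ℤ): Γ(f,g) is contained in O_Q(ℤ) (in particular Aᵀ·Q·A = Q and Bᵀ·Q·B = Q), and Γ(f,g) has finite index in O_Q(ℤ). -/

import Mathlib

open Matrix

/-- The companion matrix `A` of `f(x) = x^5 - 2*x^4 + x^3 - x^2 + 2*x - 1`. -/
def matA : Matrix (Fin 5) (Fin 5) ℤ :=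
  !![(0 : ℤ), 0, 0, 0, 1; 1, 0, 0, 0, -2; 0, 1, 0, 0, 1; 0, 0, 1, 0, -1; 0, 0, 0, 1, 2]

/-- The companion matrix `B` of `g(x) = x^5 + x^3 + x^2 + 1`. -/
def matB : Matrix (Fin 5) (Fin 5) ℤ :=
  !![(0 : ℤ), 0, 0, 0, -1; 1, 0, 0, 0, 0; 0, 1, 0, 0, -1; 0, 0, 1, 0, -1; 0, 0, 0, 1, 0]

/-- The symmetric integer matrix `Q` of the quadratic form preserved by `Γ(f,g)`. -/
def matQ : Matrix (Fin 5) (Fin 5) ℤ :=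
  !![(1 : ℤ), 3, 1, -5, -7; 3, 1, 3, 1, -5; 1, 3, 1, 3, 1; -5, 1, 3, 1, 3; -7, -5, 1, 3, 1]

/-- The integral orthogonal group `O_Q(ℤ)` of a matrix `Q`, as the subgroup of `GL₅(ℤ)`
consisting of all `M` with `Mᵀ * Q * M = Q`. -/
def orthogonalSubgroup (Q : Matrix (Fin 5) (Fin 5) ℤ) : Subgroup (GL (Fin 5) ℤ) where
  carrier := { M : GL (Fin 5) ℤ |
      (M : Matrix (Fin 5) (Fin 5) ℤ)ᵀ * Q * (M : Matrix (Fin 5) (Fin 5) ℤ) = Q }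
  one_mem' := by simp
  mul_mem' := by
    intro a b ha hb
    simp only [Set.mem_setOf_eq, Units.val_mul, transpose_mul] at ha hb ⊢
    calc ((b : Matrix (Fin 5) (Fin 5) ℤ)ᵀ * (a : Matrix (Fin 5) (Fin 5) ℤ)ᵀ) * Q *
          ((a : Matrix (Fin 5) (Fin 5) ℤ) * (b : Matrix (Fin 5) (Fin 5) ℤ))
        = (b : Matrix (Fin 5) (Fin 5) ℤ)ᵀ *
            ((a : Matrix (Fin 5) (Fin 5) ℤ)ᵀ * Q * (a : Matrix (Fin 5) (Fin 5) ℤ)) *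
            (b : Matrix (Fin 5) (Fin 5) ℤ) := by
          simp only [mul_assoc]
      _ = Q := by rw [ha, hb]
  inv_mem' := by
    intro a ha
    simp only [Set.mem_setOf_eq] at ha ⊢
    calc ((a⁻¹ : GL (Fin 5) ℤ) : Matrix (Fin 5) (Fin 5) ℤ)ᵀ * Q *
          ((a⁻¹ : GL (Fin 5) ℤ) : Matrix (Fin 5) (Fin 5) ℤ)
        = ((a⁻¹ : GL (Fin 5) ℤ) : Matrix (Fin 5) (Fin 5) ℤ)ᵀ *
            ((a : Matrix (Fin 5) (Fin 5) ℤ)ᵀ * Q * (a : Matrix (Fin 5) (Fin 5) ℤ)) *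
            ((a⁻¹ : GL (Fin 5) ℤ) : Matrix (Fin 5) (Fin 5) ℤ) := by rw [ha]
      _ = ((a : Matrix (Fin 5) (Fin 5) ℤ) *
            ((a⁻¹ : GL (Fin 5) ℤ) : Matrix (Fin 5) (Fin 5) ℤ))ᵀ * Q *
          ((a : Matrix (Fin 5) (Fin 5) ℤ) *
            ((a⁻¹ : GL (Fin 5) ℤ) : Matrix (Fin 5) (Fin 5) ℤ)) := by
          simp only [transpose_mul, mul_assoc]
      _ = Q := by rw [Units.mul_inv]; simp


/-! ### Explicit integer 5×5 matrices suited to kernel computation -/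

/-- Integer row vectors of length five. -/
structure V5 where
  x0 : ℤ
  x1 : ℤ
  x2 : ℤ
  x3 : ℤ
  x4 : ℤ

/-- Integer matrices of size five, by rows. -/
structure M5 where
  r0 : V5
  r1 : V5
  r2 : V5
  r3 : V5
  r4 : V5

namespace M5

/-- Row vector times matrix. -/
def vmul (v : V5) (m : M5) : V5 :=
  ⟨v.x0 * m.r0.x0 + v.x1 * m.r1.x0 + v.x2 * m.r2.x0 + v.x3 * m.r3.x0 + v.x4 * m.r4.x0,
   v.x0 * m.r0.x1 + v.x1 * m.r1.x1 + v.x2 * m.r2.x1 + v.x3 * m.r3.x1 + v.x4 * m.r4.x1,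
   v.x0 * m.r0.x2 + v.x1 * m.r1.x2 + v.x2 * m.r2.x2 + v.x3 * m.r3.x2 + v.x4 * m.r4.x2,
   v.x0 * m.r0.x3 + v.x1 * m.r1.x3 + v.x2 * m.r2.x3 + v.x3 * m.r3.x3 + v.x4 * m.r4.x3,
   v.x0 * m.r0.x4 + v.x1 * m.r1.x4 + v.x2 * m.r2.x4 + v.x3 * m.r3.x4 + v.x4 * m.r4.x4⟩

/-- Matrix product. -/
def mul (a b : M5) : M5 := ⟨vmul a.r0 b, vmul a.r1 b, vmul a.r2 b, vmul a.r3 b, vmul a.r4 b⟩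

/-- Identity matrix. -/
def one : M5 := ⟨⟨1,0,0,0,0⟩, ⟨0,1,0,0,0⟩, ⟨0,0,1,0,0⟩, ⟨0,0,0,1,0⟩, ⟨0,0,0,0,1⟩⟩

/-- Boolean equality of vectors. -/
def veq (a b : V5) : Bool :=
  decide (a.x0 = b.x0) && (decide (a.x1 = b.x1) && (decide (a.x2 = b.x2) &&
    (decide (a.x3 = b.x3) && decide (a.x4 = b.x4))))

/-- Boolean equality of matrices. -/
def meq (a b : M5) : Bool :=
  veq a.r0 b.r0 && (veq a.r1 b.r1 && (veq a.r2 b.r2 && (veq a.r3 b.r3 && veq a.r4 b.r4)))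

theorem veq_eq {a b : V5} (h : veq a b = true) : a = b := by
  cases a; cases b
  simpa [veq] using h

theorem meq_eq {a b : M5} (h : meq a b = true) : a = b := by
  simp only [meq, Bool.and_eq_true] at h
  obtain ⟨h0, h1, h2, h3, h4⟩ := h
  cases a; cases b
  simp only [M5.mk.injEq]
  exact ⟨veq_eq h0, veq_eq h1, veq_eq h2, veq_eq h3, veq_eq h4⟩

/-- The underlying matrix. -/
def toMat (a : M5) : Matrix (Fin 5) (Fin 5) ℤ :=
  !![a.r0.x0, a.r0.x1, a.r0.x2, a.r0.x3, a.r0.x4;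
     a.r1.x0, a.r1.x1, a.r1.x2, a.r1.x3, a.r1.x4;
     a.r2.x0, a.r2.x1, a.r2.x2, a.r2.x3, a.r2.x4;
     a.r3.x0, a.r3.x1, a.r3.x2, a.r3.x3, a.r3.x4;
     a.r4.x0, a.r4.x1, a.r4.x2, a.r4.x3, a.r4.x4]

theorem toMat_mul (a b : M5) : toMat (mul a b) = toMat a * toMat b := by
  ext i j
  fin_cases i <;> fin_cases j <;>
    simp [toMat, mul, vmul, Matrix.mul_apply, Fin.sum_univ_five]

theorem toMat_one : toMat one = 1 := by
  ext i j
  fin_cases i <;> fin_cases j <;> simp [toMat, one]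

/-- The inverse of a matrix that preserves the form `2uv + 2pq - 2t²`. -/
def iv (a : M5) : M5 :=
  ⟨⟨a.r1.x1, a.r0.x1, a.r3.x1, a.r2.x1, -2 * a.r4.x1⟩,
   ⟨a.r1.x0, a.r0.x0, a.r3.x0, a.r2.x0, -2 * a.r4.x0⟩,
   ⟨a.r1.x3, a.r0.x3, a.r3.x3, a.r2.x3, -2 * a.r4.x3⟩,
   ⟨a.r1.x2, a.r0.x2, a.r3.x2, a.r2.x2, -2 * a.r4.x2⟩,
   ⟨-(a.r1.x4 / 2), -(a.r0.x4 / 2), -(a.r3.x4 / 2), -(a.r2.x4 / 2), a.r4.x4⟩⟩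

/-- The test that `iv` really gives the inverse. -/
def good (a : M5) : Bool := meq (mul a (iv a)) one

theorem good_mul {a : M5} (h : good a = true) : toMat a * toMat (iv a) = 1 := by
  rw [← toMat_mul, meq_eq h, toMat_one]

open Classical in
/-- The element of `GL₅(ℤ)` given by an explicit matrix. -/
noncomputable def toGL (a : M5) : GL (Fin 5) ℤ :=
  if h : toMat a * toMat (iv a) = 1 then ⟨toMat a, toMat (iv a), h, mul_eq_one_comm.mp h⟩ else 1

theorem toGL_val {a : M5} (h : good a = true) : (toGL a : Matrix (Fin 5) (Fin 5) ℤ) = toMat a := by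
  rw [toGL, dif_pos (good_mul h)]

theorem toGL_inv_val {a : M5} (h : good a = true) :
    ((toGL a)⁻¹ : GL (Fin 5) ℤ).val = toMat (iv a) := by
  rw [toGL, dif_pos (good_mul h)]
  rfl

/-- The table of generators and their inverses. -/
def letters : List M5 → List M5
  | [] => []
  | g :: l => g :: iv g :: letters l

/-- Value of a word in an alphabet of matrices. -/
def ev (l : List M5) : List ℕ → M5
  | [] => one
  | k :: w => mul (l.getD k one) (ev l w)

/-- `m` is the matrix of an element of the subgroup `H`. -/
def InH (H : Subgroup (GL (Fin 5) ℤ)) (m : M5) : Prop := ∃ h ∈ H, h.val = toMat m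

theorem InH.one (H : Subgroup (GL (Fin 5) ℤ)) : InH H one := ⟨1, H.one_mem, by simp [toMat_one]⟩

theorem InH.mul {H : Subgroup (GL (Fin 5) ℤ)} {a b : M5} (ha : InH H a) (hb : InH H b) :
    InH H (mul a b) := by
  obtain ⟨x, hx, hxa⟩ := ha
  obtain ⟨y, hy, hyb⟩ := hb
  exact ⟨x * y, H.mul_mem hx hy, by rw [toMat_mul, ← hxa, ← hyb]; rfl⟩

/-- The subgroup generated by a list of explicit matrices. -/
noncomputable def grp (l : List M5) : Subgroup (GL (Fin 5) ℤ) :=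
  Subgroup.closure {g | ∃ m ∈ l, g = toGL m}

theorem toGL_mem_grp {l : List M5} {m : M5} (h : m ∈ l) : toGL m ∈ grp l :=
  Subgroup.subset_closure ⟨m, h, rfl⟩

theorem letters_InH (H : Subgroup (GL (Fin 5) ℤ)) (l : List M5) (hl : l.all good = true)
    (hH : ∀ m ∈ l, toGL m ∈ H) : ∀ m ∈ letters l, InH H m := by
  induction l with
  | nil => intro m hm; simp [letters] at hm
  | cons g l ih =>
    simp only [List.all_cons, Bool.and_eq_true] at hl
    intro m hm
    simp only [letters, List.mem_cons] at hm
    rcases hm with rfl | rfl | hm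
    · exact ⟨toGL m, hH m (by simp), toGL_val hl.1⟩
    · exact ⟨(toGL g)⁻¹, H.inv_mem (hH g (by simp)), toGL_inv_val hl.1⟩
    · exact ih hl.2 (fun m hm => hH m (by simp [hm])) m hm

theorem ev_InH (H : Subgroup (GL (Fin 5) ℤ)) (l : List M5) (hl : ∀ m ∈ l, InH H m)
    (w : List ℕ) : InH H (ev l w) := by
  induction w with
  | nil => exact InH.one H
  | cons k w ih =>
    refine InH.mul ?_ ih
    rw [List.getD_eq_getElem?_getD]
    cases h : l[k]? with
    | none => exact InH.one H
    | some m => exact hl m (List.mem_of_getElem? h)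

theorem ev_grp (l : List M5) (hl : l.all good = true) (w : List ℕ) :
    InH (grp l) (ev (letters l) w) :=
  ev_InH _ _ (letters_InH _ l hl fun _ h => toGL_mem_grp h) w

/-- Check of one row of a coset table. -/
def chkRow (reps hs : List M5) (r : M5) : List M5 → List (ℕ × List ℕ) → Bool
  | [], _ => true
  | _ :: _, [] => false
  | s :: gs, c :: row =>
    meq (mul s r) (mul (reps.getD c.1 one) (ev hs c.2)) && chkRow reps hs r gs row

/-- Check of a coset table. -/
def chkAll (gs reps hs : List M5) : List M5 → List (List (ℕ × List ℕ)) → Bool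
  | [], _ => true
  | _ :: _, [] => false
  | r :: rs, c :: tab => chkRow reps hs r gs c && chkAll gs reps hs rs tab

theorem chkRow_spec {reps hs : List M5} {r : M5} {gs : List M5} {row : List (ℕ × List ℕ)}
    (h : chkRow reps hs r gs row = true) :
    ∀ s ∈ gs, ∃ j w, mul s r = mul (reps.getD j one) (ev hs w) := by
  induction gs generalizing row with
  | nil => intro s hs; simp at hs
  | cons g gs ih =>
    cases row with
    | nil => simp [chkRow] at h
    | cons c row =>
      simp only [chkRow, Bool.and_eq_true] at h
      intro s hs
      rcases List.mem_cons.mp hs with rfl | hs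
      · exact ⟨c.1, c.2, meq_eq h.1⟩
      · exact ih h.2 s hs

theorem chkAll_spec {gs reps hs rs : List M5} {tab : List (List (ℕ × List ℕ))}
    (h : chkAll gs reps hs rs tab = true) :
    ∀ r ∈ rs, ∀ s ∈ gs, ∃ j w, mul s r = mul (reps.getD j one) (ev hs w) := by
  induction rs generalizing tab with
  | nil => intro s hs; simp at hs
  | cons g gs ih =>
    cases tab with
    | nil => simp [chkAll] at h
    | cons c tab =>
      simp only [chkAll, Bool.and_eq_true] at h
      intro s hs
      rcases List.mem_cons.mp hs with rfl | hs
      · exact chkRow_spec h.1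
      · exact ih h.2 s hs

end M5

/-- Finite index from a coset table. -/
theorem relIndex_of_table {G : Type*} [Group G] (H : Subgroup G) (S X : Set G) (hX : X.Finite)
    (h1 : (1 : G) ∈ X) (hS : ∀ s ∈ S, ∀ r ∈ X, ∃ r' ∈ X, ∃ h ∈ H, s * r = r' * h) :
    H.relIndex (Subgroup.closure S) ≠ 0 := by
  classical
  set Y : Set (G ⧸ H) := (fun x : G => (x : G ⧸ H)) '' X with hY
  have hYf : Y.Finite := hX.image _
  have hmap : ∀ s ∈ S, (fun y : G ⧸ H => s • y) '' Y = Y := by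
    intro s hs
    have hsub : (fun y : G ⧸ H => s • y) '' Y ⊆ Y := by
      rintro _ ⟨_, ⟨r, hr, rfl⟩, rfl⟩
      obtain ⟨r', hr', h, hh, e⟩ := hS s hs r hr
      refine ⟨r', hr', ?_⟩
      change (r' : G ⧸ H) = ((s * r : G) : G ⧸ H)
      rw [e]
      exact (QuotientGroup.mk_mul_of_mem r' hh).symm
    refine Set.eq_of_subset_of_ncard_le hsub ?_ hYf
    rw [Set.ncard_image_of_injective _ (MulAction.injective s)]
  have hall : ∀ g ∈ Subgroup.closure S, (fun y : G ⧸ H => g • y) '' Y = Y := by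
    intro g hg
    induction hg using Subgroup.closure_induction with
    | mem s hs => exact hmap s hs
    | one => simp
    | mul a b _ _ ha hb =>
      have : (fun y : G ⧸ H => (a * b) • y) = (fun y => a • y) ∘ (fun y => b • y) := by
        funext y; simp [mul_smul]
      rw [this, Set.image_comp, hb, ha]
    | inv a _ ha =>
      conv_lhs => rw [← ha]
      rw [← Set.image_comp]
      simp [Function.comp_def]
  have hfin : Finite ((Subgroup.closure S) ⧸ H.subgroupOf (Subgroup.closure S)) := by
    have : Finite Y := hYf
    let f : (Subgroup.closure S) ⧸ H.subgroupOf (Subgroup.closure S) → G ⧸ H :=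
      Quotient.lift (fun g : Subgroup.closure S => ((g : G) : G ⧸ H)) (by
        intro a b hab
        have h2 := QuotientGroup.leftRel_apply.mp hab
        rw [Subgroup.mem_subgroupOf] at h2
        exact QuotientGroup.eq.mpr (by simpa using h2))
    have hf : ∀ q, f q ∈ Y := by
      intro q
      induction q using QuotientGroup.induction_on with
      | H g =>
        have := hall g g.2
        rw [← this]
        refine ⟨((1 : G) : G ⧸ H), ⟨1, h1, rfl⟩, ?_⟩
        change ((g.1 * 1 : G) : G ⧸ H) = ((g : G) : G ⧸ H)
        rw [mul_one]
    have hinj : Function.Injective f := by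
      intro a b
      induction a using QuotientGroup.induction_on with
      | H a =>
      induction b using QuotientGroup.induction_on with
      | H b =>
        intro hab
        have h2 : ((a : G) : G ⧸ H) = ((b : G) : G ⧸ H) := hab
        rw [QuotientGroup.eq] at h2 ⊢
        rw [Subgroup.mem_subgroupOf]
        simpa using h2
    exact Finite.of_injective (fun q => (⟨f q, hf q⟩ : Y)) (by
      intro a b hab
      exact hinj (congrArg Subtype.val hab))
  exact Subgroup.index_ne_zero_of_finite

namespace M5

theorem relIndex_of_chk (gs hs reps : List M5) (tab : List (List (ℕ × List ℕ)))
    (hg : gs.all good = true) (hh : hs.all good = true) (hr : (one :: reps).all good = true)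
    (h : chkAll gs (one :: reps) (letters hs) (one :: reps) tab = true) :
    (grp hs).relIndex (grp gs) ≠ 0 := by
  have hone : toGL one = 1 := Units.ext ((toGL_val (by decide)).trans (by rw [toMat_one]; rfl))
  refine relIndex_of_table (grp hs) _ {x | ∃ m ∈ (one :: reps), x = toGL m} ?_ ?_ ?_
  · have : {x | ∃ m ∈ (one :: reps), x = toGL m} = toGL '' {m | m ∈ (one :: reps)} := by
      ext x; simp [eq_comm]
    rw [this]
    exact (List.finite_toSet _).image _
  · exact ⟨one, by simp, hone.symm⟩
  · rintro _ ⟨s, hs', rfl⟩ _ ⟨r, hr', rfl⟩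
    obtain ⟨j, w, e⟩ := chkAll_spec h r hr' s hs'
    have hgood := List.all_eq_true.mp hg s hs'
    have hgoodr := List.all_eq_true.mp hr
    have hmem : (one :: reps).getD j one ∈ (one :: reps) := by
      rw [List.getD_eq_getElem?_getD]
      cases hj : (one :: reps)[j]? with
      | none => simp
      | some m => exact List.mem_of_getElem? hj
    obtain ⟨x, hx, hxe⟩ := ev_grp hs hh w
    refine ⟨_, ⟨_, hmem, rfl⟩, x, hx, Units.ext ?_⟩
    rw [Units.val_mul, Units.val_mul, toGL_val hgood, toGL_val (hgoodr r hr'),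
      toGL_val (hgoodr _ hmem), hxe, ← toMat_mul, ← toMat_mul, e]

end M5

/-! ### A chain of subgroups and its coset tables -/

namespace M5

/-- Generators of the subgroup number 0 of the chain. -/
def gen0 : List M5 := [
  ⟨⟨1, 1, 0, 0, -2⟩, ⟨0, 1, 0, 0, 0⟩, ⟨0, 0, 1, 0, 0⟩, ⟨0, 0, 0, 1, 0⟩, ⟨0, -1, 0, 0, 1⟩⟩,
  ⟨⟨1, 0, 0, 1, 0⟩, ⟨0, 1, 0, 0, 0⟩, ⟨0, -1, 1, 0, 0⟩, ⟨0, 0, 0, 1, 0⟩, ⟨0, 0, 0, 0, 1⟩⟩,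
  ⟨⟨0, 1, 0, 0, 0⟩, ⟨1, 0, 0, 0, 0⟩, ⟨0, 0, 1, 0, 0⟩, ⟨0, 0, 0, 1, 0⟩, ⟨0, 0, 0, 0, 1⟩⟩,
  ⟨⟨0, 0, 1, 0, 0⟩, ⟨0, 0, 0, 1, 0⟩, ⟨1, 0, 0, 0, 0⟩, ⟨0, 1, 0, 0, 0⟩, ⟨0, 0, 0, 0, 1⟩⟩]

/-- Generators of the subgroup number 1 of the chain. -/
def gen1 : List M5 := [
  ⟨⟨0, 1, 0, 0, 0⟩, ⟨1, 0, 0, 0, 0⟩, ⟨0, 0, 0, 1, 0⟩, ⟨0, 0, 1, 0, 0⟩, ⟨0, 0, 0, 0, 1⟩⟩,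
  ⟨⟨1, 0, 0, 1, 0⟩, ⟨0, 1, 0, 0, 0⟩, ⟨0, -1, 1, 0, 0⟩, ⟨0, 0, 0, 1, 0⟩, ⟨0, 0, 0, 0, 1⟩⟩,
  ⟨⟨1, 0, 0, 0, 0⟩, ⟨0, 1, 0, 1, 0⟩, ⟨-1, 0, 1, 0, 0⟩, ⟨0, 0, 0, 1, 0⟩, ⟨0, 0, 0, 0, 1⟩⟩,
  ⟨⟨1, 1, 0, 0, -2⟩, ⟨0, 1, 0, 0, 0⟩, ⟨0, 0, 1, 0, 0⟩, ⟨0, 0, 0, 1, 0⟩, ⟨0, -1, 0, 0, 1⟩⟩]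

/-- Generators of the subgroup number 2 of the chain. -/
def gen2 : List M5 := [
  ⟨⟨0, 1, 0, 0, 0⟩, ⟨1, 0, 0, 0, 0⟩, ⟨0, 0, 0, 1, 0⟩, ⟨0, 0, 1, 0, 0⟩, ⟨0, 0, 0, 0, 1⟩⟩,
  ⟨⟨0, 1, 0, 0, 0⟩, ⟨1, 1, -1, 1, 0⟩, ⟨0, 1, 0, 1, 0⟩, ⟨0, -1, 1, 0, 0⟩, ⟨0, 0, 0, 0, 1⟩⟩,
  ⟨⟨1, 1, 0, 0, -2⟩, ⟨0, 1, 0, 0, 0⟩, ⟨0, 0, 1, 0, 0⟩, ⟨0, 0, 0, 1, 0⟩, ⟨0, -1, 0, 0, 1⟩⟩,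
  ⟨⟨1, 0, 0, 2, 0⟩, ⟨0, 1, 0, 0, 0⟩, ⟨0, -2, 1, 0, 0⟩, ⟨0, 0, 0, 1, 0⟩, ⟨0, 0, 0, 0, 1⟩⟩,
  ⟨⟨0, 1, 0, 2, 0⟩, ⟨1, 1, 0, 2, -2⟩, ⟨-2, 0, 1, 0, 0⟩, ⟨0, 0, 0, 1, 0⟩, ⟨0, 1, 0, 2, -1⟩⟩,
  ⟨⟨1, 0, 0, 0, 0⟩, ⟨4, 1, 0, 4, -4⟩, ⟨4, 0, 1, 4, -4⟩, ⟨0, 0, 0, 1, 0⟩, ⟨-2, 0, 0, -2, 1⟩⟩]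

/-- Generators of the subgroup number 3 of the chain. -/
def gen3 : List M5 := [
  ⟨⟨1, 1, 1, -1, 0⟩, ⟨1, 0, 0, 0, 0⟩, ⟨-1, 0, 0, 1, 0⟩, ⟨1, 0, 1, 0, 0⟩, ⟨0, 0, 0, 0, 1⟩⟩,
  ⟨⟨0, 1, 0, 0, 0⟩, ⟨1, 1, 0, 0, -2⟩, ⟨0, 0, 0, 1, 0⟩, ⟨0, 0, 1, 0, 0⟩, ⟨0, -1, 0, 0, 1⟩⟩,
  ⟨⟨1, 0, 0, 2, 0⟩, ⟨0, 1, 0, 0, 0⟩, ⟨0, -2, 1, 0, 0⟩, ⟨0, 0, 0, 1, 0⟩, ⟨0, 0, 0, 0, 1⟩⟩]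

/-- Generators of the last subgroup of the chain. -/
def gen4 : List M5 := [
  ⟨⟨1, 1, 1, -1, 0⟩, ⟨1, 0, 0, 0, 0⟩, ⟨1, 0, 1, 0, 0⟩, ⟨3, 0, 4, 1, 4⟩, ⟨-2, 0, -2, 0, -1⟩⟩,
  ⟨⟨-2, 1, -3, -1, -2⟩, ⟨1, 1, 1, -1, 0⟩, ⟨1, 0, 1, 0, 0⟩, ⟨3, 4, 4, -3, 0⟩, ⟨-1, -1, -1, 1, 1⟩⟩,
  ⟨⟨1, 1, 0, 0, 2⟩, ⟨1, 0, 0, 0, 0⟩, ⟨0, 0, 1, 0, 0⟩, ⟨4, 0, 4, 1, 4⟩, ⟨-1, 0, -2, 0, -1⟩⟩]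

/-- Nontrivial coset representatives of step 0. -/
def rep0 : List M5 := [
  ⟨⟨0, 1, 0, 0, 0⟩, ⟨1, 0, 0, 0, 0⟩, ⟨0, 0, 1, 0, 0⟩, ⟨0, 0, 0, 1, 0⟩, ⟨0, 0, 0, 0, 1⟩⟩,
  ⟨⟨0, 0, 1, 0, 0⟩, ⟨0, 0, 0, 1, 0⟩, ⟨1, 0, 0, 0, 0⟩, ⟨0, 1, 0, 0, 0⟩, ⟨0, 0, 0, 0, 1⟩⟩,
  ⟨⟨0, 0, 1, 0, 0⟩, ⟨0, 0, 0, 1, 0⟩, ⟨0, 1, 0, 0, 0⟩, ⟨1, 0, 0, 0, 0⟩, ⟨0, 0, 0, 0, 1⟩⟩]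

/-- Coset table of step 0. -/
def tab0 : List (List (ℕ × List ℕ)) := [
  [(0, [6]), (0, [2]), (1, []), (2, [])],
  [(1, [0, 6, 0]), (1, [4]), (0, []), (3, [])],
  [(2, [2, 4, 7, 5, 6]), (2, [3]), (3, [0]), (0, [])],
  [(3, [2, 4, 7, 5, 6]), (3, [5]), (2, [0]), (1, [])]]

theorem step0 : (grp gen1).relIndex (grp gen0) ≠ 0 :=
  relIndex_of_chk gen0 gen1 rep0 tab0 (by decide +kernel) (by decide +kernel)
    (by decide +kernel) (by decide +kernel)

/-- Nontrivial coset representatives of step 1. -/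
def rep1 : List M5 := [
  ⟨⟨1, 0, 0, 1, 0⟩, ⟨0, 1, 0, 0, 0⟩, ⟨0, -1, 1, 0, 0⟩, ⟨0, 0, 0, 1, 0⟩, ⟨0, 0, 0, 0, 1⟩⟩,
  ⟨⟨1, 0, 0, 0, 0⟩, ⟨0, 1, 0, 1, 0⟩, ⟨-1, 0, 1, 0, 0⟩, ⟨0, 0, 0, 1, 0⟩, ⟨0, 0, 0, 0, 1⟩⟩,
  ⟨⟨1, 0, 0, 1, 0⟩, ⟨0, 1, 0, 1, 0⟩, ⟨-1, -1, 1, -1, 0⟩, ⟨0, 0, 0, 1, 0⟩, ⟨0, 0, 0, 0, 1⟩⟩,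
  ⟨⟨0, 1, 0, 1, 0⟩, ⟨1, 0, 0, 1, 0⟩, ⟨0, 0, 0, 1, 0⟩, ⟨-1, -1, 1, -1, 0⟩, ⟨0, 0, 0, 0, 1⟩⟩,
  ⟨⟨-1, 0, 1, 0, 0⟩, ⟨1, 0, 0, 1, 0⟩, ⟨-1, 0, 0, 0, 0⟩, ⟨-1, -1, 1, -1, 0⟩, ⟨0, 0, 0, 0, 1⟩⟩,
  ⟨⟨1, 1, 0, 1, -2⟩, ⟨0, 1, 0, 1, 0⟩, ⟨-1, 0, 1, 0, 0⟩, ⟨0, 0, 0, 1, 0⟩, ⟨0, -1, 0, -1, 1⟩⟩,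
  ⟨⟨0, 0, 1, 1, -2⟩, ⟨1, 0, 0, 1, 0⟩, ⟨-1, 0, 0, 0, 0⟩, ⟨-1, -1, 1, -1, 0⟩, ⟨-1, 0, 0, -1, 1⟩⟩,
  ⟨⟨1, 1, 0, 0, -2⟩, ⟨0, 1, 0, 1, 0⟩, ⟨-1, 1, 1, 1, 0⟩, ⟨0, 0, 0, 1, 0⟩, ⟨0, -1, 0, -1, 1⟩⟩,
  ⟨⟨1, 0, 0, 1, 0⟩, ⟨0, 0, 1, 1, -2⟩, ⟨-1, -1, 1, -1, 0⟩, ⟨-1, 0, 0, 0, 0⟩, ⟨-1, 0, 0, -1, 1⟩⟩,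
  ⟨⟨1, 0, 0, 1, 0⟩, ⟨1, 0, 1, 1, -2⟩, ⟨0, -1, 1, 0, 0⟩, ⟨-1, 0, 0, 0, 0⟩, ⟨-1, 0, 0, -1, 1⟩⟩,
  ⟨⟨1, 1, 0, 1, -2⟩, ⟨0, 1, 0, 0, 0⟩, ⟨0, 1, 1, 1, -2⟩, ⟨0, 0, 0, 1, 0⟩, ⟨0, -1, 0, -1, 1⟩⟩,
  ⟨⟨0, 1, 0, 0, 0⟩, ⟨1, 1, 0, 1, -2⟩, ⟨0, 0, 0, 1, 0⟩, ⟨0, 1, 1, 1, -2⟩, ⟨0, -1, 0, -1, 1⟩⟩,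
  ⟨⟨1, 1, 0, 0, -2⟩, ⟨0, 1, 0, 0, 0⟩, ⟨0, 2, 1, 1, -2⟩, ⟨0, 0, 0, 1, 0⟩, ⟨0, -1, 0, -1, 1⟩⟩,
  ⟨⟨0, 1, 0, 0, 0⟩, ⟨1, 1, 0, 0, -2⟩, ⟨0, 0, 0, 1, 0⟩, ⟨0, 2, 1, 1, -2⟩, ⟨0, -1, 0, -1, 1⟩⟩]

/-- Coset table of step 1. -/
def tab1 : List (List (ℕ × List ℕ)) := [
  [(0, [0]), (1, []), (2, []), (0, [4])],
  [(2, [2]), (0, [6]), (3, []), (1, [4])],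
  [(1, [3]), (3, []), (0, [8, 6, 9]), (6, [])],
  [(4, []), (2, [6]), (1, [8, 6, 9]), (8, [6])],
  [(3, []), (5, []), (5, [2, 0, 2]), (12, [8])],
  [(5, [2, 0, 3]), (4, [3, 6, 2]), (4, [2, 0, 6, 2]), (7, [])],
  [(6, [3, 5, 3, 4]), (8, [6]), (11, [9, 6, 8]), (2, [2, 10, 3])],
  [(9, []), (12, [8, 3, 6, 2]), (7, [2, 0, 4, 6, 2]), (5, [10])],
  [(10, [3, 7]), (6, []), (13, [9, 6, 8]), (3, [2, 10, 3, 7])],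
  [(7, []), (9, [0, 4, 6, 3]), (10, [8, 6, 9]), (9, [9, 5, 0, 9, 6])],
  [(8, [6, 2]), (10, [0, 4, 6, 3]), (9, []), (10, [2, 5, 7, 9, 6])],
  [(12, []), (13, [6]), (6, []), (11, [4, 6])],
  [(11, []), (7, [9]), (12, [0, 4, 8, 2]), (4, [10, 9])],
  [(14, []), (11, []), (8, []), (13, [4, 6])],
  [(13, []), (14, [8, 2, 0, 4]), (14, [0, 4, 8, 2]), (14, [8, 4])]]

theorem step1 : (grp gen2).relIndex (grp gen1) ≠ 0 :=
  relIndex_of_chk gen1 gen2 rep1 tab1 (by decide +kernel) (by decide +kernel)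
    (by decide +kernel) (by decide +kernel)

/-- Nontrivial coset representatives of step 2. -/
def rep2 : List M5 := [
  ⟨⟨0, 1, 0, 0, 0⟩, ⟨1, 0, 0, 0, 0⟩, ⟨0, 0, 0, 1, 0⟩, ⟨0, 0, 1, 0, 0⟩, ⟨0, 0, 0, 0, 1⟩⟩]

/-- Coset table of step 2. -/
def tab2 : List (List (ℕ × List ℕ)) := [
  [(1, []), (0, [5, 2, 1, 4, 1, 4, 2, 2, 5, 3]), (1, [2]), (0, [4]), (0, [1, 3, 3, 1, 2, 1, 4, 3]), (0, [2, 1, 5, 1, 2, 5, 0, 4])],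
  [(0, []), (1, [0]), (0, [0, 5, 0, 5, 0, 3, 0, 4, 1, 4]), (1, [2, 4, 3]), (1, [5, 0, 3, 0, 2, 1, 4, 2, 4, 3]), (1, [0, 2, 5, 0, 5, 2, 2, 4, 3])]]

theorem step2 : (grp gen3).relIndex (grp gen2) ≠ 0 :=
  relIndex_of_chk gen2 gen3 rep2 tab2 (by decide +kernel) (by decide +kernel)
    (by decide +kernel) (by decide +kernel)

/-- Nontrivial coset representatives of step 3. -/
def rep3 : List M5 := [
  ⟨⟨1, 1, 1, -1, 0⟩, ⟨1, 0, 0, 0, 0⟩, ⟨-1, 0, 0, 1, 0⟩, ⟨1, 0, 1, 0, 0⟩, ⟨0, 0, 0, 0, 1⟩⟩,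
  ⟨⟨0, 1, 0, 0, 0⟩, ⟨1, 1, 1, -1, 0⟩, ⟨0, -1, 0, 1, 0⟩, ⟨0, 1, 1, 0, 0⟩, ⟨0, 0, 0, 0, 1⟩⟩,
  ⟨⟨-1, 1, -1, -1, 0⟩, ⟨1, 0, 0, 0, 0⟩, ⟨1, 0, 0, 1, 0⟩, ⟨1, 0, 1, 0, 0⟩, ⟨0, 0, 0, 0, 1⟩⟩,
  ⟨⟨1, 0, 0, 2, 0⟩, ⟨0, 1, 0, 0, 0⟩, ⟨0, -2, 1, 0, 0⟩, ⟨0, 0, 0, 1, 0⟩, ⟨0, 0, 0, 0, 1⟩⟩,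
  ⟨⟨0, 1, 0, 0, 0⟩, ⟨1, -1, 1, 1, 0⟩, ⟨0, -1, 0, 1, 0⟩, ⟨0, -1, 1, 0, 0⟩, ⟨0, 0, 0, 0, 1⟩⟩,
  ⟨⟨1, 0, 0, -2, 0⟩, ⟨0, 1, 0, 0, 0⟩, ⟨0, 2, 1, 0, 0⟩, ⟨0, 0, 0, 1, 0⟩, ⟨0, 0, 0, 0, 1⟩⟩,
  ⟨⟨1, 0, 0, 0, 0⟩, ⟨0, 1, -2, 0, 0⟩, ⟨0, 0, 1, 0, 0⟩, ⟨2, 0, 0, 1, 0⟩, ⟨0, 0, 0, 0, 1⟩⟩,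
  ⟨⟨0, 1, 0, 0, 0⟩, ⟨1, 1, 0, -2, -2⟩, ⟨0, 0, 0, 1, 0⟩, ⟨0, 2, 1, 0, 0⟩, ⟨0, -1, 0, 0, 1⟩⟩,
  ⟨⟨0, 1, -1, -1, 2⟩, ⟨-1, 1, -1, -1, 0⟩, ⟨1, 0, 1, 0, 0⟩, ⟨1, 0, 0, 1, 0⟩, ⟨-1, 1, -1, -1, 1⟩⟩,
  ⟨⟨1, -1, 1, 1, 0⟩, ⟨1, 0, 1, 1, -2⟩, ⟨0, -1, 1, 0, 0⟩, ⟨0, -1, 0, 1, 0⟩, ⟨-1, 1, -1, -1, 1⟩⟩,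
  ⟨⟨0, 1, -2, 0, 0⟩, ⟨-1, 1, -1, -1, 0⟩, ⟨2, -1, 2, 1, 0⟩, ⟨0, 1, -1, 0, 0⟩, ⟨0, 0, 0, 0, 1⟩⟩,
  ⟨⟨0, -1, 0, 0, 0⟩, ⟨-1, 1, -1, -1, 0⟩, ⟨0, 1, 0, -1, 0⟩, ⟨0, 1, -1, 0, 0⟩, ⟨0, 0, 0, 0, 1⟩⟩,
  ⟨⟨-1, 0, 0, -2, 0⟩, ⟨0, -1, 0, 0, 0⟩, ⟨0, 2, -1, 0, 0⟩, ⟨0, 0, 0, -1, 0⟩, ⟨0, 0, 0, 0, 1⟩⟩,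
  ⟨⟨-1, 0, 0, 0, 0⟩, ⟨0, -1, 0, 0, 0⟩, ⟨0, 0, -1, 0, 0⟩, ⟨0, 0, 0, -1, 0⟩, ⟨0, 0, 0, 0, 1⟩⟩,
  ⟨⟨-1, -1, -1, 1, 0⟩, ⟨-1, 0, 0, 0, 0⟩, ⟨1, 0, 0, -1, 0⟩, ⟨-1, 0, -1, 0, 0⟩, ⟨0, 0, 0, 0, 1⟩⟩,
  ⟨⟨0, -1, 0, 0, 0⟩, ⟨-1, -1, -1, 1, 0⟩, ⟨0, 1, 0, -1, 0⟩, ⟨0, -1, -1, 0, 0⟩, ⟨0, 0, 0, 0, 1⟩⟩,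
  ⟨⟨1, -1, 1, 1, 0⟩, ⟨-1, 0, 0, 0, 0⟩, ⟨-1, 0, 0, -1, 0⟩, ⟨-1, 0, -1, 0, 0⟩, ⟨0, 0, 0, 0, 1⟩⟩,
  ⟨⟨-1, 0, 0, 2, 0⟩, ⟨0, -1, 0, 0, 0⟩, ⟨0, -2, -1, 0, 0⟩, ⟨0, 0, 0, -1, 0⟩, ⟨0, 0, 0, 0, 1⟩⟩,
  ⟨⟨-1, 0, 0, 0, 0⟩, ⟨0, -1, 2, 0, 0⟩, ⟨0, 0, -1, 0, 0⟩, ⟨-2, 0, 0, -1, 0⟩, ⟨0, 0, 0, 0, 1⟩⟩,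
  ⟨⟨0, -1, 0, 0, 0⟩, ⟨-1, -1, 0, 2, -2⟩, ⟨0, 0, 0, -1, 0⟩, ⟨0, -2, -1, 0, 0⟩, ⟨0, 1, 0, 0, 1⟩⟩,
  ⟨⟨-1, 1, -1, -1, 0⟩, ⟨-1, 0, -1, -1, -2⟩, ⟨0, 1, -1, 0, 0⟩, ⟨0, 1, 0, -1, 0⟩, ⟨1, -1, 1, 1, 1⟩⟩,
  ⟨⟨1, 1, 0, -2, 2⟩, ⟨1, 0, 0, -2, 0⟩, ⟨0, 0, 0, 1, 0⟩, ⟨0, 2, 1, 0, 0⟩, ⟨1, 0, 0, -2, 1⟩⟩,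
  ⟨⟨-1, -1, 0, 2, 2⟩, ⟨-1, 0, 0, 2, 0⟩, ⟨0, 0, 0, -1, 0⟩, ⟨0, -2, -1, 0, 0⟩, ⟨-1, 0, 0, 2, 1⟩⟩,
  ⟨⟨3, 1, 3, -1, 0⟩, ⟨1, 0, 0, 0, 0⟩, ⟨-3, 0, 0, 1, 0⟩, ⟨1, 0, 1, 0, 0⟩, ⟨0, 0, 0, 0, 1⟩⟩,
  ⟨⟨1, 0, 0, 0, 0⟩, ⟨0, 1, 2, 0, 0⟩, ⟨0, 0, 1, 0, 0⟩, ⟨-2, 0, 0, 1, 0⟩, ⟨0, 0, 0, 0, 1⟩⟩,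
  ⟨⟨0, 1, 2, 0, 0⟩, ⟨1, 1, 2, 0, -2⟩, ⟨-2, 0, 0, 1, 0⟩, ⟨0, 0, 1, 0, 0⟩, ⟨0, -1, -2, 0, 1⟩⟩,
  ⟨⟨-3, 1, -3, -1, 0⟩, ⟨1, 0, 0, 0, 0⟩, ⟨3, 0, 0, 1, 0⟩, ⟨1, 0, 1, 0, 0⟩, ⟨0, 0, 0, 0, 1⟩⟩,
  ⟨⟨-3, -1, -3, 1, 0⟩, ⟨-1, 0, 0, 0, 0⟩, ⟨3, 0, 0, -1, 0⟩, ⟨-1, 0, -1, 0, 0⟩, ⟨0, 0, 0, 0, 1⟩⟩,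
  ⟨⟨-1, 0, 0, 0, 0⟩, ⟨0, -1, -2, 0, 0⟩, ⟨0, 0, -1, 0, 0⟩, ⟨2, 0, 0, -1, 0⟩, ⟨0, 0, 0, 0, 1⟩⟩,
  ⟨⟨0, -1, -2, 0, 0⟩, ⟨-1, -1, -2, 0, -2⟩, ⟨2, 0, 0, -1, 0⟩, ⟨0, 0, -1, 0, 0⟩, ⟨0, 1, 2, 0, 1⟩⟩,
  ⟨⟨3, -1, 3, 1, 0⟩, ⟨-1, 0, 0, 0, 0⟩, ⟨-3, 0, 0, -1, 0⟩, ⟨-1, 0, -1, 0, 0⟩, ⟨0, 0, 0, 0, 1⟩⟩]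

/-- Coset table of step 3. -/
def tab3 : List (List (ℕ × List ℕ)) := [
  [(1, []), (2, [2, 4, 3, 3, 1, 2]), (4, [])],
  [(2, []), (0, [5, 0]), (24, [])],
  [(0, []), (1, [4, 3, 3, 1, 2, 2]), (6, [0, 0, 2, 4, 4, 1, 2, 4, 1, 4, 2, 2, 0, 0])],
  [(11, []), (7, [5, 0]), (1, [])],
  [(21, [3, 5, 3, 0, 4]), (5, [2, 4, 3, 3, 1, 2]), (2, [4, 3, 3, 1, 2, 2, 4, 3, 5, 3, 0, 4])],
  [(4, []), (10, []), (9, [3, 0, 2, 2, 0, 2, 4, 2])],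
  [(23, [0, 5, 3, 3, 0, 2, 2, 0, 2, 2, 5, 3, 3, 0, 0]), (8, []), (0, [])],
  [(3, []), (9, [3, 0, 2, 0, 5, 0, 4, 4, 2]), (26, [3, 0, 2, 0, 4, 3, 3, 1, 3, 5, 5, 1, 4, 4])],
  [(6, [2, 4, 3, 3, 1, 2]), (22, [0, 5, 3, 0, 5, 3, 5, 3, 1, 3, 0, 0, 0, 0]), (22, [4, 1, 4, 2, 2, 0, 0, 0, 5])],
  [(19, [3, 5, 3, 1, 3, 3, 1, 2]), (3, []), (25, [1, 4, 4, 3, 5, 5, 1, 3, 5, 5, 1, 4, 4])],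
  [(12, [3, 0, 2, 2, 0, 2, 4, 2]), (4, [3, 0, 4, 2, 4, 3, 5, 3, 1, 3, 3, 1, 2]), (5, [3, 0, 4, 2, 4, 2, 2, 4, 3, 3, 1, 2])],
  [(7, []), (17, [3, 0, 4, 4, 2]), (29, [4, 3, 1, 3, 0, 0, 5, 1, 1, 3, 3, 5, 5, 1, 4, 4])],
  [(13, []), (21, []), (11, [])],
  [(10, [3, 5, 3, 1, 3, 3, 1, 2]), (12, [4, 1]), (16, [4, 3, 3, 1, 2, 2, 4, 3, 5, 3, 0, 4])],
  [(15, []), (16, [4, 1]), (13, [])],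
  [(16, []), (14, [3, 0, 2, 0, 4, 2, 2, 4, 2, 0, 2, 5]), (28, [])],
  [(14, []), (15, [1, 1, 2]), (18, [0, 0, 2, 4, 4, 1, 2, 4, 1, 4, 2, 2, 0, 0])],
  [(9, [3, 0, 2, 2, 0, 2, 4, 2]), (19, [3, 0, 2, 0, 4, 2, 2, 4, 2, 0, 2, 5]), (15, [])],
  [(22, [1, 1, 2, 4, 4, 0, 5, 3, 3, 5, 3, 3, 0, 4, 2, 4, 1]), (20, []), (14, [])],
  [(17, []), (11, [3, 0, 2, 0, 4, 1, 4]), (30, [1, 1, 3, 0, 5, 0, 4, 4, 4, 4])],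
  [(18, [4, 1]), (23, [1, 1, 3, 3, 5, 3, 5, 5, 0, 5, 1, 1, 3, 3, 5, 0, 5]), (23, [3, 0, 5, 0, 4, 1, 1, 3, 5, 1, 1, 3, 0, 5, 5, 5, 3, 0, 4])],
  [(5, [3, 0, 4, 4, 2]), (13, [3, 0, 2, 2, 5, 3, 3, 0, 4, 2, 2, 0, 4]), (12, [3, 0, 2, 2, 5, 3, 5, 3, 0, 4])],
  [(20, [4, 3, 1, 3, 0, 2, 2, 0, 2, 0, 4, 3, 3, 1, 4, 1, 2]), (6, []), (7, [2, 0, 0, 4, 1, 4, 4, 1, 2, 2, 4, 3, 5, 0, 5])],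
  [(8, [1, 1, 1, 4, 3, 3, 1, 2, 2]), (18, []), (19, [3, 0, 2, 0, 4, 1, 1, 3, 3, 5, 0, 5, 1, 1, 3, 5, 1, 1, 4, 1])],
  [(30, [4, 3, 5, 5]), (25, [5, 0]), (27, [5, 0, 5, 1, 1, 3, 5, 1, 1, 3, 0, 5, 5, 5])],
  [(24, []), (26, []), (10, [3, 0, 2, 0, 4, 4, 2, 5])],
  [(29, [4, 2, 2, 0, 2, 2, 5]), (24, [4, 4, 2, 5, 0, 0, 2, 5]), (8, [4, 1, 4, 3, 3, 1, 3, 3, 5])],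
  [(27, [3, 5, 5, 0, 5, 1, 1, 3, 1, 4]), (27, [5, 0, 2, 0, 0, 4, 1, 4, 4, 2, 5, 0]), (3, [])],
  [(26, [4, 3, 3, 1, 3, 3, 5]), (29, [3, 0, 2, 0, 4, 2, 2, 4, 2, 0, 2, 5]), (31, [5, 0, 5, 1, 1, 3, 5, 1, 1, 3, 0, 5, 5, 5])],
  [(28, []), (30, []), (21, [5, 3, 3, 0, 2, 2, 5])],
  [(25, [4, 4, 2, 5]), (28, [1, 4, 1, 2, 0, 2, 4, 2, 5]), (20, [2, 4, 3, 5, 3, 0, 5, 5])],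
  [(31, [3, 5, 5, 0, 5, 1, 1, 3, 1, 4]), (31, [0, 4, 4, 2, 5, 5, 0, 5, 0, 4, 4, 2]), (17, [])]]

theorem step3 : (grp gen4).relIndex (grp gen3) ≠ 0 :=
  relIndex_of_chk gen3 gen4 rep3 tab3 (by decide +kernel) (by decide +kernel)
    (by decide +kernel) (by decide +kernel)

theorem chain_index : (grp gen4).relIndex (grp gen0) ≠ 0 :=
  Subgroup.relIndex_ne_zero_trans step3
    (Subgroup.relIndex_ne_zero_trans step2 (Subgroup.relIndex_ne_zero_trans step1 step0))

end M5

/-! ### The orthogonal group of the split lattice is generated by `gen0` -/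

namespace M5

/-- Gram matrix of the form `2uv + 2pq - 2t²`. -/
def matK : Matrix (Fin 5) (Fin 5) ℤ :=
  !![(0 : ℤ), 1, 0, 0, 0; 1, 0, 0, 0, 0; 0, 0, 0, 1, 0; 0, 0, 1, 0, 0; 0, 0, 0, 0, -2]

/-- The bilinear form of `matK`. -/
def bil (x y : Fin 5 → ℤ) : ℤ := x 0 * y 1 + x 1 * y 0 + x 2 * y 3 + x 3 * y 2 - 2 * (x 4 * y 4)

theorem bil_eq (x y : Fin 5 → ℤ) : x ⬝ᵥ (matK *ᵥ y) = bil x y := by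
  simp [bil, matK, dotProduct, mulVec, Fin.sum_univ_five]
  ring

theorem bil_map {N : GL (Fin 5) ℤ} (hN : N ∈ orthogonalSubgroup matK) (x y : Fin 5 → ℤ) :
    bil (N.val *ᵥ x) (N.val *ᵥ y) = bil x y := by
  have h : N.valᵀ * matK * N.val = matK := hN
  rw [← bil_eq, ← bil_eq]
  conv_rhs => rw [← h]
  rw [Matrix.dotProduct_mulVec, Matrix.dotProduct_mulVec, Matrix.dotProduct_mulVec,
    ← Matrix.vecMul_vecMul, ← Matrix.vecMul_vecMul, Matrix.vecMul_transpose]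

/-- The pointwise stabilizer of a vector. -/
def fixer (e : Fin 5 → ℤ) : Subgroup (GL (Fin 5) ℤ) where
  carrier := {g | g.val *ᵥ e = e}
  one_mem' := by simp
  mul_mem' := by
    intro a b ha hb
    change (a * b).val *ᵥ e = e
    rw [Units.val_mul, ← Matrix.mulVec_mulVec, show b.val *ᵥ e = e from hb]
    exact ha
  inv_mem' := by
    intro a ha
    have ha' : a.val *ᵥ e = e := ha
    change (a⁻¹).val *ᵥ e = e
    conv_lhs => rw [← ha']
    rw [Matrix.mulVec_mulVec, Units.inv_mul, Matrix.one_mulVec]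

/-- Two vectors in the same orbit of `H`. -/
def Rel (H : Subgroup (GL (Fin 5) ℤ)) (x y : Fin 5 → ℤ) : Prop := ∃ g ∈ H, g.val *ᵥ x = y

theorem Rel.refl (H : Subgroup (GL (Fin 5) ℤ)) (x : Fin 5 → ℤ) : Rel H x x :=
  ⟨1, H.one_mem, by simp⟩

theorem Rel.trans {H : Subgroup (GL (Fin 5) ℤ)} {x y z : Fin 5 → ℤ} (h : Rel H x y)
    (h' : Rel H y z) : Rel H x z := by
  obtain ⟨a, ha, rfl⟩ := h
  obtain ⟨b, hb, rfl⟩ := h'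
  exact ⟨b * a, H.mul_mem hb ha, by rw [Matrix.mulVec_mulVec]; rfl⟩

theorem Rel.symm {H : Subgroup (GL (Fin 5) ℤ)} {x y : Fin 5 → ℤ} (h : Rel H x y) :
    Rel H y x := by
  obtain ⟨a, ha, rfl⟩ := h
  exact ⟨a⁻¹, H.inv_mem ha, by rw [Matrix.mulVec_mulVec, Units.inv_mul, Matrix.one_mulVec]⟩

theorem Rel.iter {H : Subgroup (GL (Fin 5) ℤ)} (f : ℤ → Fin 5 → ℤ)
    (h : ∀ k, Rel H (f k) (f (k + 1))) (k : ℤ) : Rel H (f 0) (f k) := by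
  induction k using Int.induction_on with
  | zero => exact Rel.refl _ _
  | succ n ih => exact ih.trans (h _)
  | pred n ih =>
    refine ih.trans ?_
    have := h (-(n : ℤ) - 1)
    rw [sub_add_cancel] at this
    exact this.symm

theorem toMat_mulVec (m : M5) (u v p q t : ℤ) : toMat m *ᵥ ![u, v, p, q, t] =
    ![m.r0.x0 * u + m.r0.x1 * v + m.r0.x2 * p + m.r0.x3 * q + m.r0.x4 * t,
      m.r1.x0 * u + m.r1.x1 * v + m.r1.x2 * p + m.r1.x3 * q + m.r1.x4 * t,
      m.r2.x0 * u + m.r2.x1 * v + m.r2.x2 * p + m.r2.x3 * q + m.r2.x4 * t,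
      m.r3.x0 * u + m.r3.x1 * v + m.r3.x2 * p + m.r3.x3 * q + m.r3.x4 * t,
      m.r4.x0 * u + m.r4.x1 * v + m.r4.x2 * p + m.r4.x3 * q + m.r4.x4 * t] := by
  ext i
  fin_cases i <;> simp [toMat, mulVec, dotProduct, Fin.sum_univ_five]

theorem InH.rel {H : Subgroup (GL (Fin 5) ℤ)} {m : M5} (h : InH H m) (u v p q t : ℤ) :
    Rel H ![u, v, p, q, t]
    ![m.r0.x0 * u + m.r0.x1 * v + m.r0.x2 * p + m.r0.x3 * q + m.r0.x4 * t,
      m.r1.x0 * u + m.r1.x1 * v + m.r1.x2 * p + m.r1.x3 * q + m.r1.x4 * t,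
      m.r2.x0 * u + m.r2.x1 * v + m.r2.x2 * p + m.r2.x3 * q + m.r2.x4 * t,
      m.r3.x0 * u + m.r3.x1 * v + m.r3.x2 * p + m.r3.x3 * q + m.r3.x4 * t,
      m.r4.x0 * u + m.r4.x1 * v + m.r4.x2 * p + m.r4.x3 * q + m.r4.x4 * t] := by
  obtain ⟨g, hg, e⟩ := h
  exact ⟨g, hg, by rw [e, toMat_mulVec]⟩

theorem InH.fix {H : Subgroup (GL (Fin 5) ℤ)} {m : M5} (h : InH H m) (e : Fin 5 → ℤ)
    (he : toMat m *ᵥ e = e) : InH (H ⊓ fixer e) m := by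
  obtain ⟨g, hg, e'⟩ := h
  exact ⟨g, ⟨hg, by change g.val *ᵥ e = e; rw [e', he]⟩, e'⟩

theorem good0 : gen0.all good = true := by decide +kernel

theorem inG0 (m : M5) (w : List ℕ) (h : meq (ev (letters gen0) w) m = true) :
    InH (grp gen0) m := by
  rw [← meq_eq h]
  exact ev_grp gen0 good0 w

/-- Swap of the first two coordinates. -/
def sUV : M5 := ⟨⟨0,1,0,0,0⟩, ⟨1,0,0,0,0⟩, ⟨0,0,1,0,0⟩, ⟨0,0,0,1,0⟩, ⟨0,0,0,0,1⟩⟩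
/-- Swap of the two hyperbolic planes. -/
def sXY : M5 := ⟨⟨0,0,1,0,0⟩, ⟨0,0,0,1,0⟩, ⟨1,0,0,0,0⟩, ⟨0,1,0,0,0⟩, ⟨0,0,0,0,1⟩⟩
/-- Swap of the coordinates `p`, `q`. -/
def sPQ : M5 := ⟨⟨1,0,0,0,0⟩, ⟨0,1,0,0,0⟩, ⟨0,0,0,1,0⟩, ⟨0,0,1,0,0⟩, ⟨0,0,0,0,1⟩⟩
/-- Transvection. -/
def e12 : M5 := ⟨⟨1,0,0,0,0⟩, ⟨0,1,0,1,0⟩, ⟨-1,0,1,0,0⟩, ⟨0,0,0,1,0⟩, ⟨0,0,0,0,1⟩⟩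
/-- Transvection. -/
def e13 : M5 := ⟨⟨1,0,0,0,0⟩, ⟨0,1,1,0,0⟩, ⟨0,0,1,0,0⟩, ⟨-1,0,0,1,0⟩, ⟨0,0,0,0,1⟩⟩
/-- Transvection. -/
def e02 : M5 := ⟨⟨1,0,0,1,0⟩, ⟨0,1,0,0,0⟩, ⟨0,-1,1,0,0⟩, ⟨0,0,0,1,0⟩, ⟨0,0,0,0,1⟩⟩
/-- Transvection. -/
def e03 : M5 := ⟨⟨1,0,1,0,0⟩, ⟨0,1,0,0,0⟩, ⟨0,0,1,0,0⟩, ⟨0,-1,0,1,0⟩, ⟨0,0,0,0,1⟩⟩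
/-- Transvection. -/
def e04 : M5 := ⟨⟨1,1,0,0,-2⟩, ⟨0,1,0,0,0⟩, ⟨0,0,1,0,0⟩, ⟨0,0,0,1,0⟩, ⟨0,-1,0,0,1⟩⟩
/-- Transvection. -/
def e14 : M5 := ⟨⟨1,0,0,0,0⟩, ⟨1,1,0,0,-2⟩, ⟨0,0,1,0,0⟩, ⟨0,0,0,1,0⟩, ⟨-1,0,0,0,1⟩⟩
/-- Transvection. -/
def e24 : M5 := ⟨⟨1,0,0,0,0⟩, ⟨0,1,0,0,0⟩, ⟨0,0,1,1,-2⟩, ⟨0,0,0,1,0⟩, ⟨0,0,0,-1,1⟩⟩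
/-- Transvection. -/
def e34 : M5 := ⟨⟨1,0,0,0,0⟩, ⟨0,1,0,0,0⟩, ⟨0,0,1,0,0⟩, ⟨0,0,1,1,-2⟩, ⟨0,0,-1,0,1⟩⟩
/-- Sign change on both hyperbolic planes. -/
def nX : M5 := ⟨⟨-1,0,0,0,0⟩, ⟨0,-1,0,0,0⟩, ⟨0,0,-1,0,0⟩, ⟨0,0,0,-1,0⟩, ⟨0,0,0,0,1⟩⟩
/-- Sign change on the second hyperbolic plane. -/
def nP : M5 := ⟨⟨1,0,0,0,0⟩, ⟨0,1,0,0,0⟩, ⟨0,0,-1,0,0⟩, ⟨0,0,0,-1,0⟩, ⟨0,0,0,0,1⟩⟩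
/-- Sign change of the last coordinate. -/
def nT : M5 := ⟨⟨1,0,0,0,0⟩, ⟨0,1,0,0,0⟩, ⟨0,0,1,0,0⟩, ⟨0,0,0,1,0⟩, ⟨0,0,0,0,-1⟩⟩

theorem h_sUV : InH (grp gen0) sUV := inG0 _ [4] (by decide +kernel)
theorem h_sXY : InH (grp gen0) sXY := inG0 _ [6] (by decide +kernel)
theorem h_sPQ : InH (grp gen0) sPQ := inG0 _ [6, 4, 6] (by decide +kernel)
theorem h_e02 : InH (grp gen0) e02 := inG0 _ [2] (by decide +kernel)
theorem h_e12 : InH (grp gen0) e12 := inG0 _ [4, 2, 4] (by decide +kernel)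
theorem h_e03 : InH (grp gen0) e03 := inG0 _ [6, 4, 6, 2, 6, 4, 6] (by decide +kernel)
theorem h_e13 : InH (grp gen0) e13 :=
  inG0 _ [4, 6, 4, 6, 2, 6, 4, 6, 4] (by decide +kernel)
theorem h_e04 : InH (grp gen0) e04 := inG0 _ [0] (by decide +kernel)
theorem h_e14 : InH (grp gen0) e14 := inG0 _ [4, 0, 4] (by decide +kernel)
theorem h_e24 : InH (grp gen0) e24 := inG0 _ [6, 0, 6] (by decide +kernel)
theorem h_e34 : InH (grp gen0) e34 := inG0 _ [6, 4, 0, 4, 6] (by decide +kernel)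
theorem h_nX : InH (grp gen0) nX :=
  inG0 _ [2, 6, 4, 6, 2, 4, 2, 6, 4, 6, 2, 4, 2, 6, 4, 6, 2, 4] (by decide +kernel)
theorem h_nP : InH (grp gen0) nP :=
  inG0 _ [2, 4, 6, 4, 3, 4, 6, 4, 2, 4, 6, 4] (by decide +kernel)
theorem h_nT : InH (grp gen0) nT := inG0 _ [0, 4, 1, 4, 0, 4] (by decide +kernel)

theorem vec_congr {a b c d e a' b' c' d' e' : ℤ} (h0 : a = a') (h1 : b = b') (h2 : c = c')
    (h3 : d = d') (h4 : e = e') : (![a, b, c, d, e] : Fin 5 → ℤ) = ![a', b', c', d', e'] := by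
  subst h0 h1 h2 h3 h4; rfl

theorem grp_le : grp gen0 ≤ orthogonalSubgroup matK := by
  rw [grp, Subgroup.closure_le]
  rintro _ ⟨m, hm, rfl⟩
  change (toGL m).valᵀ * matK * (toGL m).val = matK
  rw [toGL_val (List.all_eq_true.mp good0 m hm)]
  simp only [gen0, List.mem_cons, List.not_mem_nil, or_false] at hm
  rcases hm with rfl | rfl | rfl | rfl <;> decide +kernel

section iterates
variable {H : Subgroup (GL (Fin 5) ℤ)} (u v p q t k : ℤ)

theorem it12 (h : InH H e12) : Rel H ![u, v, p, q, t] ![u, v + k * q, p - k * u, q, t] := by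
  have := Rel.iter (H := H) (fun k => ![u, v + k * q, p - k * u, q, t]) (fun k => by
    convert h.rel u (v + k * q) (p - k * u) q t using 1
    apply vec_congr <;> simp only [e12] <;> ring) k
  simpa using this

theorem it13 (h : InH H e13) : Rel H ![u, v, p, q, t] ![u, v + k * p, p, q - k * u, t] := by
  have := Rel.iter (H := H) (fun k => ![u, v + k * p, p, q - k * u, t]) (fun k => by
    convert h.rel u (v + k * p) p (q - k * u) t using 1
    apply vec_congr <;> simp only [e13] <;> ring) k
  simpa using this

theorem it02 (h : InH H e02) : Rel H ![u, v, p, q, t] ![u + k * q, v, p - k * v, q, t] := by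
  have := Rel.iter (H := H) (fun k => ![u + k * q, v, p - k * v, q, t]) (fun k => by
    convert h.rel (u + k * q) v (p - k * v) q t using 1
    apply vec_congr <;> simp only [e02] <;> ring) k
  simpa using this

theorem it03 (h : InH H e03) : Rel H ![u, v, p, q, t] ![u + k * p, v, p, q - k * v, t] := by
  have := Rel.iter (H := H) (fun k => ![u + k * p, v, p, q - k * v, t]) (fun k => by
    convert h.rel (u + k * p) v p (q - k * v) t using 1
    apply vec_congr <;> simp only [e03] <;> ring) k
  simpa using this

theorem it04 (h : InH H e04) :
    Rel H ![u, v, p, q, t] ![u - 2 * k * t + k * k * v, v, p, q, t - k * v] := by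
  have := Rel.iter (H := H) (fun k => ![u - 2 * k * t + k * k * v, v, p, q, t - k * v])
    (fun k => by
    convert h.rel (u - 2 * k * t + k * k * v) v p q (t - k * v) using 1
    apply vec_congr <;> simp only [e04] <;> ring) k
  simpa using this

theorem it14 (h : InH H e14) :
    Rel H ![u, v, p, q, t] ![u, v - 2 * k * t + k * k * u, p, q, t - k * u] := by
  have := Rel.iter (H := H) (fun k => ![u, v - 2 * k * t + k * k * u, p, q, t - k * u])
    (fun k => by
    convert h.rel u (v - 2 * k * t + k * k * u) p q (t - k * u) using 1
    apply vec_congr <;> simp only [e14] <;> ring) k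
  simpa using this

theorem it24 (h : InH H e24) :
    Rel H ![u, v, p, q, t] ![u, v, p - 2 * k * t + k * k * q, q, t - k * q] := by
  have := Rel.iter (H := H) (fun k => ![u, v, p - 2 * k * t + k * k * q, q, t - k * q])
    (fun k => by
    convert h.rel u v (p - 2 * k * t + k * k * q) q (t - k * q) using 1
    apply vec_congr <;> simp only [e24] <;> ring) k
  simpa using this

theorem it34 (h : InH H e34) :
    Rel H ![u, v, p, q, t] ![u, v, p, q - 2 * k * t + k * k * p, t - k * p] := by
  have := Rel.iter (H := H) (fun k => ![u, v, p, q - 2 * k * t + k * k * p, t - k * p])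
    (fun k => by
    convert h.rel u v p (q - 2 * k * t + k * k * p) (t - k * p) using 1
    apply vec_congr <;> simp only [e34] <;> ring) k
  simpa using this

theorem itUV (h : InH H sUV) : Rel H ![u, v, p, q, t] ![v, u, p, q, t] := by
  convert h.rel u v p q t using 1
  apply vec_congr <;> simp only [sUV] <;> ring

theorem itXY (h : InH H sXY) : Rel H ![u, v, p, q, t] ![p, q, u, v, t] := by
  convert h.rel u v p q t using 1
  apply vec_congr <;> simp only [sXY] <;> ring

theorem itPQ (h : InH H sPQ) : Rel H ![u, v, p, q, t] ![u, v, q, p, t] := by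
  convert h.rel u v p q t using 1
  apply vec_congr <;> simp only [sPQ] <;> ring

end iterates

/-- The Smith normal form argument: primitive isotropic vectors form one orbit. -/
theorem orbit_aux (n : ℕ) : ∀ u v p q t : ℤ, u.natAbs = n → u ≠ 0 → u * v + p * q = t * t →
    (∀ d : ℤ, d ∣ u → d ∣ v → d ∣ p → d ∣ q → d ∣ t → IsUnit d) →
    Rel (grp gen0) ![u, v, p, q, t] ![1, 0, 0, 0, 0] := by
  induction n using Nat.strong_induction_on with
  | _ n ih =>
  -- the case where `u` does not divide `p`
  have caseP : ∀ u v p q t : ℤ, u.natAbs = n → u ≠ 0 → u * v + p * q = t * t →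
      (∀ d : ℤ, d ∣ u → d ∣ v → d ∣ p → d ∣ q → d ∣ t → IsUnit d) → ¬ u ∣ p →
      Rel (grp gen0) ![u, v, p, q, t] ![1, 0, 0, 0, 0] := by
    intro u v p q t hn hu hiso hprim hnd
    refine (it12 u v p q t (p / u) h_e12).trans ((itXY _ _ _ _ _ h_sXY).trans ?_)
    have hm : p - p / u * u = p % u := by rw [Int.emod_def]; ring
    have hne : p % u ≠ 0 := fun h0 => hnd (Int.dvd_of_emod_eq_zero h0)
    refine ih (p - p / u * u).natAbs ?_ _ _ _ _ _ rfl (by rw [hm]; exact hne) ?_ ?_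
    · rw [hm]
      have h1 := Int.emod_nonneg p hu
      have h2 := Int.emod_lt_abs p hu
      rw [Int.abs_eq_natAbs] at h2
      omega
    · linear_combination hiso
    · intro d hp hq hu' hv ht
      have hp' : d ∣ p := by
        have := dvd_add hp (Dvd.dvd.mul_left hu' (p / u))
        simpa using this
      refine hprim d hu' ?_ hp' hq ht
      have := dvd_sub hv (Dvd.dvd.mul_left hq (p / u))
      simpa using this
  intro u v p q t hn hu hiso hprim
  by_cases hp : u ∣ p
  swap
  · exact caseP u v p q t hn hu hiso hprim hp
  by_cases hq : u ∣ q
  swap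
  · refine (itPQ _ _ _ _ _ h_sPQ).trans (caseP u v q p t hn hu (by linear_combination hiso) ?_ hq)
    intro d a b c e f
    exact hprim d a b e c f
  obtain ⟨a, rfl⟩ := hp
  obtain ⟨b, rfl⟩ := hq
  -- clear `p` and `q`
  have r1 := (it12 u v (u * a) (u * b) t a h_e12).trans (it13 _ _ _ _ _ b h_e13)
  have e1 : u * a - a * u = 0 := by ring
  have e2 : u * b - b * u = 0 := by ring
  rw [e1, e2] at r1
  refine r1.trans ?_
  set v' := v + a * (u * b) + b * 0 with hv'
  have hiso' : u * v' = t * t := by rw [hv']; linear_combination hiso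
  have hprim' : ∀ d : ℤ, d ∣ u → d ∣ v' → d ∣ t → IsUnit d := by
    intro d h1 h2 h3
    refine hprim d h1 ?_ (h1.mul_right _) (h1.mul_right _) h3
    have : v = v' - u * (a * b) := by rw [hv']; ring
    rw [this]
    exact dvd_sub h2 (h1.mul_right _)
  by_cases hd : u ∣ v'
  swap
  · refine (it03 u v' 0 0 t (-1) h_e03).trans ((itPQ _ _ _ _ _ h_sPQ).trans ?_)
    refine caseP _ _ _ _ _ (by simpa using hn) (by simpa using hu) (by linear_combination hiso')
      ?_ (by simpa using hd)
    intro d h1 h2 _ _ h5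
    exact hprim' d (by simpa using h1) h2 h5
  obtain ⟨m, hm⟩ := hd
  have hut : u ∣ t := by
    have : u ^ 2 ∣ t ^ 2 := ⟨m, by rw [hm] at hiso'; linear_combination -hiso'⟩
    exact (Int.pow_dvd_pow_iff two_ne_zero).mp this
  have hunit : IsUnit u := hprim' u dvd_rfl ⟨m, hm⟩ hut
  obtain ⟨c, hc⟩ := hut
  have r2 := it14 u v' 0 0 t c h_e14
  have e3 : t - c * u = 0 := by rw [hc]; ring
  have e4 : v' - 2 * c * t + c * c * u = 0 := by
    have : u * (v' - 2 * c * t + c * c * u) = 0 := by rw [hc] at hiso' ⊢; linear_combination hiso'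
    exact (mul_eq_zero.mp this).resolve_left hu
  rw [e3, e4] at r2
  refine r2.trans ?_
  rcases Int.isUnit_iff.mp hunit with rfl | rfl
  · exact Rel.refl _ _
  · convert h_nX.rel (-1) 0 0 0 0 using 1
    apply vec_congr <;> simp [nX]

theorem orbit1 (u v p q t : ℤ) (hiso : u * v + p * q = t * t)
    (hprim : ∀ d : ℤ, d ∣ u → d ∣ v → d ∣ p → d ∣ q → d ∣ t → IsUnit d) :
    Rel (grp gen0) ![u, v, p, q, t] ![1, 0, 0, 0, 0] := by
  by_cases hu : u = 0
  swap
  · exact orbit_aux _ u v p q t rfl hu hiso hprim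
  by_cases hv : v = 0
  swap
  · exact (itUV _ _ _ _ _ h_sUV).trans (orbit_aux _ v u p q t rfl hv (by linear_combination hiso)
      fun d a b => hprim d b a)
  by_cases hp : p = 0
  swap
  · exact (itXY _ _ _ _ _ h_sXY).trans (orbit_aux _ p q u v t rfl hp (by linear_combination hiso)
      fun d a b c e => hprim d c e a b)
  by_cases hq : q = 0
  swap
  · exact (itXY _ _ _ _ _ h_sXY).trans ((itUV _ _ _ _ _ h_sUV).trans
      (orbit_aux _ q p u v t rfl hq (by linear_combination hiso)
      fun d a b c e => hprim d c e b a))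
  subst hu hv hp hq
  have ht : t = 0 := by
    have : t * t = 0 := by linarith
    simpa using this
  subst ht
  exact absurd (hprim 0 dvd_rfl dvd_rfl dvd_rfl dvd_rfl dvd_rfl) not_isUnit_zero

theorem orbit2_aux {H : Subgroup (GL (Fin 5) ℤ)} (h02 : InH H e02) (h03 : InH H e03)
    (h34 : InH H e34) (hPQ : InH H sPQ) (hnP : InH H nP) (n : ℕ) : ∀ u p q t : ℤ, t.natAbs = n →
    p * q = t * t → (∀ d : ℤ, d ∣ p → d ∣ q → d ∣ t → IsUnit d) →
    Rel H ![u, 0, p, q, t] ![0, 0, 1, 0, 0] := by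
  induction n using Nat.strong_induction_on with
  | _ n ih =>
  -- the case `q = t = 0`
  have case0 : ∀ u p : ℤ, (∀ d : ℤ, d ∣ p → IsUnit d) →
      Rel H ![u, 0, p, 0, 0] ![0, 0, 1, 0, 0] := by
    intro u p hprim
    have hp := hprim p dvd_rfl
    have hpp : p * p = 1 := by
      rcases Int.isUnit_iff.mp hp with rfl | rfl <;> rfl
    have r := it03 u 0 p 0 0 (-u * p) h03
    have e1 : u + -u * p * p = 0 := by linear_combination -u * hpp
    have e2 : 0 - -u * p * 0 = (0 : ℤ) := by ring
    rw [e1, e2] at r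
    refine r.trans ?_
    rcases Int.isUnit_iff.mp hp with rfl | rfl
    · exact Rel.refl _ _
    · convert hnP.rel 0 0 (-1) 0 0 using 1
      apply vec_congr <;> simp [nP]
  -- the case `|p| ≤ |t|`
  have caseP : ∀ u p q t : ℤ, t.natAbs = n → t ≠ 0 → p.natAbs ≤ t.natAbs →
      p * q = t * t → (∀ d : ℤ, d ∣ p → d ∣ q → d ∣ t → IsUnit d) →
      Rel H ![u, 0, p, q, t] ![0, 0, 1, 0, 0] := by
    intro u p q t hn ht hle hiso hprim
    have hp : p ≠ 0 := by
      rintro rfl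
      apply ht
      have : t * t = 0 := by linarith
      simpa using this
    obtain ⟨k, hk⟩ : ∃ k : ℤ, (t - k * p).natAbs < t.natAbs := by
      rcases lt_or_gt_of_ne ht with h1 | h1 <;> rcases lt_or_gt_of_ne hp with h2 | h2
      · exact ⟨1, by omega⟩
      · exact ⟨-1, by omega⟩
      · exact ⟨-1, by omega⟩
      · exact ⟨1, by omega⟩
    refine (it34 u 0 p q t k h34).trans (ih _ (hn ▸ hk) _ _ _ _ rfl ?_ ?_)
    · linear_combination hiso
    · intro d h1 h2 h3
      have h4 : d ∣ t := by
        have := dvd_add h3 (h1.mul_left k)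
        simpa using this
      refine hprim d h1 ?_ h4
      have e : q = (q - 2 * k * t + k * k * p) + t * (2 * k) - p * (k * k) := by ring
      rw [e]
      exact dvd_sub (dvd_add h2 (h4.mul_right _)) (h1.mul_right _)
  intro u p q t hn hiso hprim
  by_cases ht : t = 0
  · subst ht
    rcases mul_eq_zero.mp (hiso.trans (mul_zero 0)) with rfl | rfl
    · exact (itPQ _ _ _ _ _ hPQ).trans (case0 u q fun d h => hprim d (dvd_zero d) h (dvd_zero d))
    · exact case0 u p fun d h => hprim d h (dvd_zero d) (dvd_zero d)
  · by_cases hle : p.natAbs ≤ t.natAbs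
    · exact caseP u p q t hn ht hle hiso hprim
    · refine (itPQ _ _ _ _ _ hPQ).trans (caseP u q p t hn ht ?_ (by linear_combination hiso)
        fun d a b => hprim d b a)
      by_contra hlt
      have h1 : p.natAbs * q.natAbs = t.natAbs * t.natAbs := by
        rw [← Int.natAbs_mul, ← Int.natAbs_mul, hiso]
      nlinarith

theorem vec_eta (x : Fin 5 → ℤ) : x = ![x 0, x 1, x 2, x 3, x 4] := by
  ext i; fin_cases i <;> rfl

theorem eq_one_of_fix (M : GL (Fin 5) ℤ) (k0 : M.val *ᵥ ![1, 0, 0, 0, 0] = ![1, 0, 0, 0, 0])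
    (k1 : M.val *ᵥ ![0, 1, 0, 0, 0] = ![0, 1, 0, 0, 0])
    (k2 : M.val *ᵥ ![0, 0, 1, 0, 0] = ![0, 0, 1, 0, 0])
    (k3 : M.val *ᵥ ![0, 0, 0, 1, 0] = ![0, 0, 0, 1, 0])
    (k4 : M.val *ᵥ ![0, 0, 0, 0, 1] = ![0, 0, 0, 0, 1]) : M = 1 := by
  apply Units.ext
  ext i j
  fin_cases j
  · have e := congrFun k0 i
    simp only [mulVec, dotProduct, Fin.sum_univ_five] at e
    fin_cases i <;> simpa using e
  · have e := congrFun k1 i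
    simp only [mulVec, dotProduct, Fin.sum_univ_five] at e
    fin_cases i <;> simpa using e
  · have e := congrFun k2 i
    simp only [mulVec, dotProduct, Fin.sum_univ_five] at e
    fin_cases i <;> simpa using e
  · have e := congrFun k3 i
    simp only [mulVec, dotProduct, Fin.sum_univ_five] at e
    fin_cases i <;> simpa using e
  · have e := congrFun k4 i
    simp only [mulVec, dotProduct, Fin.sum_univ_five] at e
    fin_cases i <;> simpa using e

set_option maxHeartbeats 2000000 in
/-- Every integral isometry of the split lattice lies in the group generated by `gen0`. -/
theorem le_grp : orthogonalSubgroup matK ≤ grp gen0 := by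
  set G := grp gen0 with hG
  set O := orthogonalSubgroup matK with hO
  -- the basis vectors
  set b0 : Fin 5 → ℤ := ![1, 0, 0, 0, 0] with hb0
  set b1 : Fin 5 → ℤ := ![0, 1, 0, 0, 0] with hb1
  set b2 : Fin 5 → ℤ := ![0, 0, 1, 0, 0] with hb2
  set b3 : Fin 5 → ℤ := ![0, 0, 0, 1, 0] with hb3
  set b4 : Fin 5 → ℤ := ![0, 0, 0, 0, 1] with hb4
  have reduce : ∀ (N g : GL (Fin 5) ℤ), g ∈ G → g * N ∈ G → N ∈ G := by
    intro N g hg h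
    have := G.mul_mem (G.inv_mem hg) h
    simpa using this
  have mulv : ∀ (N g : GL (Fin 5) ℤ) (x : Fin 5 → ℤ), (g * N).val *ᵥ x = g.val *ᵥ (N.val *ᵥ x) := by
    intro N g x
    rw [Matrix.mulVec_mulVec]; rfl
  have fixb : ∀ (m : M5) (u v p q t : ℤ), _ → toMat m *ᵥ ![u, v, p, q, t] = ![u, v, p, q, t] :=
    fun m u v p q t h => (toMat_mulVec m u v p q t).trans h
  -- last stage
  have st5 : ∀ N ∈ O, N.val *ᵥ b0 = b0 → N.val *ᵥ b1 = b1 → N.val *ᵥ b2 = b2 →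
      N.val *ᵥ b3 = b3 → N ∈ G := by
    intro N hN h0 h1 h2 h3
    have c0 := bil_map hN b0 b4
    have c1 := bil_map hN b1 b4
    have c2 := bil_map hN b2 b4
    have c3 := bil_map hN b3 b4
    have c4 := bil_map hN b4 b4
    rw [h0] at c0; rw [h1] at c1; rw [h2] at c2; rw [h3] at c3
    set x := N.val *ᵥ b4 with hx
    simp [bil, hb0, hb1, hb2, hb3, hb4] at c0 c1 c2 c3 c4
    rw [c0, c1, c2, c3] at c4
    have c5 : x 4 * x 4 = 1 := by linarith
    have hx' := vec_eta x
    rw [c0, c1, c2, c3] at hx'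
    rcases mul_self_eq_one_iff.mp c5 with h | h
    · rw [h] at hx'
      rw [eq_one_of_fix N h0 h1 h2 h3 hx']
      exact G.one_mem
    · rw [h] at hx'
      obtain ⟨g, hg, hge⟩ := h_nT
      refine reduce N g hg ?_
      rw [eq_one_of_fix (g * N)]
      · exact G.one_mem
      · rw [mulv, h0, hge]; exact fixb _ _ _ _ _ _ (by simp [nT])
      · rw [mulv, h1, hge]; exact fixb _ _ _ _ _ _ (by simp [nT])
      · rw [mulv, h2, hge]; exact fixb _ _ _ _ _ _ (by simp [nT])
      · rw [mulv, h3, hge]; exact fixb _ _ _ _ _ _ (by simp [nT])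
      · rw [mulv, ← hx, hx', hge, toMat_mulVec]; simp [nT, hb4]
  have st4 : ∀ N ∈ O, N.val *ᵥ b0 = b0 → N.val *ᵥ b1 = b1 → N.val *ᵥ b2 = b2 → N ∈ G := by
    intro N hN h0 h1 h2
    have c0 := bil_map hN b0 b3
    have c1 := bil_map hN b1 b3
    have c2 := bil_map hN b2 b3
    have c3 := bil_map hN b3 b3
    rw [h0] at c0; rw [h1] at c1; rw [h2] at c2
    set x := N.val *ᵥ b3 with hx
    simp [bil, hb0, hb1, hb2, hb3] at c0 c1 c2 c3
    have hx' := vec_eta x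
    rw [c0, c1, c2] at hx' c3
    have he : InH (((G ⊓ fixer b0) ⊓ fixer b1) ⊓ fixer b2) e24 :=
      ((h_e24.fix _ (fixb _ _ _ _ _ _ (by simp [e24]))).fix _
        (fixb _ _ _ _ _ _ (by simp [e24]))).fix _ (fixb _ _ _ _ _ _ (by simp [e24]))
    obtain ⟨g, ⟨⟨⟨hg, g0⟩, g1⟩, g2⟩, hgx⟩ := it24 0 0 (x 2) 1 (x 4) (x 4) he
    refine reduce N g hg (st5 (g * N) (O.mul_mem (grp_le hg) hN) ?_ ?_ ?_ ?_)
    · rw [mulv, h0]; exact g0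
    · rw [mulv, h1]; exact g1
    · rw [mulv, h2]; exact g2
    · rw [mulv, ← hx, hx', hgx]
      apply vec_congr <;> first | rfl | ring_nf
      linarith
  have st3 : ∀ N ∈ O, N.val *ᵥ b0 = b0 → N.val *ᵥ b2 = b2 → N ∈ G := by
    intro N hN h0 h2
    have c0 := bil_map hN b0 b1
    have c2 := bil_map hN b2 b1
    have c1 := bil_map hN b1 b1
    rw [h0] at c0; rw [h2] at c2
    set x := N.val *ᵥ b1 with hx
    simp [bil, hb0, hb1, hb2] at c0 c1 c2
    have hx' := vec_eta x
    rw [c0, c2] at hx' c1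
    have he4 : InH ((G ⊓ fixer b0) ⊓ fixer b2) e04 :=
      (h_e04.fix _ (fixb _ _ _ _ _ _ (by simp [e04]))).fix _ (fixb _ _ _ _ _ _ (by simp [e04]))
    have he2 : InH ((G ⊓ fixer b0) ⊓ fixer b2) e02 :=
      (h_e02.fix _ (fixb _ _ _ _ _ _ (by simp [e02]))).fix _ (fixb _ _ _ _ _ _ (by simp [e02]))
    obtain ⟨g, ⟨⟨hg, g0⟩, g2⟩, hgx⟩ := (it04 (x 0) 1 (x 2) 0 (x 4) (x 4) he4).trans
      (it02 _ _ _ _ _ (x 2) he2)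
    refine reduce N g hg (st4 (g * N) (O.mul_mem (grp_le hg) hN) ?_ ?_ ?_)
    · rw [mulv, h0]; exact g0
    · rw [mulv, ← hx, hx', hgx]
      apply vec_congr <;> first | rfl | ring_nf
      linarith
    · rw [mulv, h2]; exact g2
  have st2 : ∀ N ∈ O, N.val *ᵥ b0 = b0 → N ∈ G := by
    intro N hN h0
    have c0 := bil_map hN b0 b2
    have c2 := bil_map hN b2 b2
    have c3 := bil_map hN b2 b3
    have c4 := bil_map hN b0 b3
    rw [h0] at c0 c4
    set x := N.val *ᵥ b2 with hx
    set y := N.val *ᵥ b3 with hy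
    simp [bil, hb0, hb2, hb3] at c0 c2 c3 c4
    have hx' := vec_eta x
    rw [c0] at hx' c2 c3
    rw [c4] at c3
    obtain ⟨g, ⟨hg, g0⟩, hgx⟩ := orbit2_aux (H := G ⊓ fixer b0)
      (h_e02.fix _ (fixb _ _ _ _ _ _ (by simp [e02])))
      (h_e03.fix _ (fixb _ _ _ _ _ _ (by simp [e03])))
      (h_e34.fix _ (fixb _ _ _ _ _ _ (by simp [e34])))
      (h_sPQ.fix _ (fixb _ _ _ _ _ _ (by simp [sPQ])))
      (h_nP.fix _ (fixb _ _ _ _ _ _ (by simp [nP])))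
      _ (x 0) (x 2) (x 3) (x 4) rfl (by linarith) (by
        intro d h1 h2 h3
        apply isUnit_of_dvd_one
        rw [← c3]
        apply dvd_sub
        · simpa using dvd_add (h1.mul_right (y 3)) (h2.mul_right (y 2))
        · exact (h3.mul_right (y 4)).mul_left 2)
    refine reduce N g hg (st3 (g * N) (O.mul_mem (grp_le hg) hN) ?_ ?_)
    · rw [mulv, h0]; exact g0
    · rw [mulv, ← hx, hx', hgx]
  intro N hN
  have c0 := bil_map hN b0 b0
  have c1 := bil_map hN b0 b1
  set x := N.val *ᵥ b0 with hx
  set y := N.val *ᵥ b1 with hy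
  simp [bil, hb0, hb1] at c0 c1
  have hx' := vec_eta x
  obtain ⟨g, hg, hgx⟩ := orbit1 (x 0) (x 1) (x 2) (x 3) (x 4) (by linarith) (by
    intro d h0 h1 h2 h3 h4
    apply isUnit_of_dvd_one
    rw [← c1]
    apply dvd_sub
    · exact dvd_add (dvd_add (dvd_add (h0.mul_right _) (h1.mul_right _)) (h2.mul_right _))
        (h3.mul_right _)
    · exact (h4.mul_right (y 4)).mul_left 2)
  refine reduce N g hg (st2 (g * N) (O.mul_mem (grp_le hg) hN) ?_)
  rw [mulv, ← hx, hx', hgx]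

end M5

/-! ### Transfer from the split lattice to the original lattice -/

namespace M5

/-- Change of basis from the split lattice to the original one. -/
def matR : Matrix (Fin 5) (Fin 5) ℤ :=
  !![(0 : ℤ), 0, -1, 1, 2; 0, 2, 1, -1, -2; 2, 0, 6, 2, 8; 0, -2, -1, 1, -2; -2, 0, -1, 1, 2]

/-- Eight times the inverse of `matR`. -/
def matR8 : Matrix (Fin 5) (Fin 5) ℤ :=
  !![(4 : ℤ), 0, 0, 0, -4; 4, 4, 0, 0, 0; -3, 1, 1, 1, 1; 5, 5, 1, 5, 1; 0, -2, 0, -2, 0]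

theorem R_R8 : matR * matR8 = (8 : ℤ) • (1 : Matrix (Fin 5) (Fin 5) ℤ) := by decide +kernel

theorem R8_R : matR8 * matR = (8 : ℤ) • (1 : Matrix (Fin 5) (Fin 5) ℤ) := by decide +kernel

theorem R_Q : matRᵀ * matQ * matR = (32 : ℤ) • matK := by decide +kernel

theorem R_cancel {X Y : Matrix (Fin 5) (Fin 5) ℤ} (h : matR * X = matR * Y) : X = Y := by
  have h1 : matR8 * (matR * X) = matR8 * (matR * Y) := by rw [h]
  rw [← Matrix.mul_assoc, ← Matrix.mul_assoc, R8_R, Matrix.smul_mul, Matrix.smul_mul,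
    Matrix.one_mul, Matrix.one_mul] at h1
  exact smul_right_injective _ (by norm_num : (8 : ℤ) ≠ 0) h1

/-- The congruence `P ≡ 1` modulo `8` allows one to transport `P` to the split lattice. -/
theorem lift_aux (P : Matrix (Fin 5) (Fin 5) ℤ)
    (hP : P.map (Int.castRingHom (ZMod 8)) = 1) :
    ∃ N : Matrix (Fin 5) (Fin 5) ℤ, matR * N = P * matR := by
  have h : ∀ i j, ∃ c : ℤ, P i j = (1 : Matrix (Fin 5) (Fin 5) ℤ) i j + 8 * c := by
    intro i j
    have h1 := congrFun (congrFun hP i) j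
    have h2 : (((P i j - (1 : Matrix (Fin 5) (Fin 5) ℤ) i j : ℤ)) : ZMod 8) = 0 := by
      have h3 : ((P i j : ℤ) : ZMod 8) = (1 : Matrix (Fin 5) (Fin 5) (ZMod 8)) i j := h1
      rw [Int.cast_sub, h3]
      by_cases hij : i = j
      · subst hij; simp
      · simp [Matrix.one_apply_ne hij]
    obtain ⟨c, hc⟩ := (ZMod.intCast_zmod_eq_zero_iff_dvd _ 8).mp h2
    exact ⟨c, by push_cast at hc; linarith⟩
  choose c hc using h
  have hPc : P = 1 + (8 : ℤ) • (Matrix.of c) := by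
    ext i j
    rw [hc]
    simp
  refine ⟨1 + matR8 * Matrix.of c * matR, ?_⟩
  rw [Matrix.mul_add, Matrix.mul_one, ← Matrix.mul_assoc, ← Matrix.mul_assoc, R_R8, hPc,
    Matrix.add_mul, Matrix.one_mul, Matrix.smul_mul, Matrix.one_mul]

theorem lift_gl (P : GL (Fin 5) ℤ) (hQ : P ∈ orthogonalSubgroup matQ)
    (hP : Matrix.GeneralLinearGroup.map (Int.castRingHom (ZMod 8)) P = 1) :
    ∃ N ∈ orthogonalSubgroup matK, matR * N.val = P.val * matR := by
  have h1 : P.val.map (Int.castRingHom (ZMod 8)) = 1 := congrArg Units.val hP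
  have hPi : Matrix.GeneralLinearGroup.map (Int.castRingHom (ZMod 8)) P⁻¹ = 1 := by
    rw [map_inv, hP, inv_one]
  have h2 : (P⁻¹).val.map (Int.castRingHom (ZMod 8)) = 1 := congrArg Units.val hPi
  obtain ⟨N, hN⟩ := lift_aux _ h1
  obtain ⟨N', hN'⟩ := lift_aux _ h2
  have e1 : N * N' = 1 := by
    apply R_cancel
    rw [← Matrix.mul_assoc, hN, Matrix.mul_assoc, hN', ← Matrix.mul_assoc, Units.mul_inv,
      Matrix.one_mul, Matrix.mul_one]
  refine ⟨⟨N, N', e1, mul_eq_one_comm.mp e1⟩, ?_, hN⟩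
  change Nᵀ * matK * N = matK
  have hQ' : P.valᵀ * matQ * P.val = matQ := hQ
  have e2 : (32 : ℤ) • (Nᵀ * matK * N) = (32 : ℤ) • matK := by
    calc (32 : ℤ) • (Nᵀ * matK * N) = Nᵀ * ((32 : ℤ) • matK) * N := by
          rw [Matrix.mul_smul, Matrix.smul_mul]
      _ = (matR * N)ᵀ * matQ * (matR * N) := by
          rw [← R_Q, Matrix.transpose_mul]; simp only [Matrix.mul_assoc]
      _ = matRᵀ * (P.valᵀ * matQ * P.val) * matR := by
          rw [hN, Matrix.transpose_mul]; simp only [Matrix.mul_assoc]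
      _ = (32 : ℤ) • matK := by rw [hQ', R_Q]
  exact smul_right_injective _ (by norm_num : (32 : ℤ) ≠ 0) e2

/-- The inclusion of `GL₅(ℤ)` in `GL₅(ℚ)`. -/
noncomputable def phi : GL (Fin 5) ℤ →* GL (Fin 5) ℚ :=
  Matrix.GeneralLinearGroup.map (Int.castRingHom ℚ)

theorem phi_val (g : GL (Fin 5) ℤ) : (phi g).val = g.val.map (Int.castRingHom ℚ) := rfl

theorem phi_inj : Function.Injective phi := by
  intro a b h
  have h1 : a.val.map (Int.castRingHom ℚ) = b.val.map (Int.castRingHom ℚ) := congrArg Units.val h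
  apply Units.ext
  ext i j
  have h2 := congrFun (congrFun h1 i) j
  exact Int.cast_injective (α := ℚ) h2

theorem cast_R_R8 : matR.map (Int.castRingHom ℚ) *
    ((1 / 8 : ℚ) • matR8.map (Int.castRingHom ℚ)) = 1 := by
  rw [Matrix.mul_smul, ← Matrix.map_mul, R_R8]
  ext i j
  rw [Matrix.smul_apply, Matrix.map_apply, Matrix.smul_apply]
  by_cases hij : i = j
  · subst hij
    rw [Matrix.one_apply_eq, Matrix.one_apply_eq]
    norm_num
  · rw [Matrix.one_apply_ne hij, Matrix.one_apply_ne hij]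
    norm_num

/-- The change of basis as an element of `GL₅(ℚ)`. -/
noncomputable def glR : GL (Fin 5) ℚ :=
  ⟨matR.map (Int.castRingHom ℚ), (1 / 8 : ℚ) • matR8.map (Int.castRingHom ℚ), cast_R_R8,
    mul_eq_one_comm.mp cast_R_R8⟩

/-- The embedding of `GL₅(ℤ)` attached to the split lattice. -/
noncomputable def psi : GL (Fin 5) ℤ →* GL (Fin 5) ℚ :=
  (MulAut.conj glR).toMonoidHom.comp phi

theorem psi_inj : Function.Injective psi :=
  (MulAut.conj glR).injective.comp phi_inj

theorem psi_eq {N P : GL (Fin 5) ℤ} (h : matR * N.val = P.val * matR) : psi N = phi P := by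
  change glR * phi N * glR⁻¹ = phi P
  rw [mul_inv_eq_iff_eq_mul]
  apply Units.ext
  change matR.map (Int.castRingHom ℚ) * N.val.map (Int.castRingHom ℚ) =
    P.val.map (Int.castRingHom ℚ) * matR.map (Int.castRingHom ℚ)
  rw [← Matrix.map_mul, ← Matrix.map_mul, h]

theorem good4 : gen4.all good = true := by decide +kernel

theorem gen4_le (A B : GL (Fin 5) ℤ) (hA : A.val = matA) (hB : B.val = matB) :
    (grp gen4).map psi ≤ (Subgroup.closure {A, B}).map phi := by
  have mA : A ∈ Subgroup.closure {A, B} := Subgroup.subset_closure (by simp)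
  have mB : B ∈ Subgroup.closure {A, B} := Subgroup.subset_closure (by simp)
  rw [Subgroup.map_le_iff_le_comap, grp, Subgroup.closure_le]
  rintro _ ⟨m, hm, rfl⟩
  change psi (toGL m) ∈ (Subgroup.closure {A, B}).map phi
  have hv := toGL_val (List.all_eq_true.mp good4 m hm)
  simp only [gen4, List.mem_cons, List.not_mem_nil, or_false] at hm
  rcases hm with rfl | rfl | rfl
  · refine ⟨A, mA, (psi_eq ?_).symm⟩
    rw [hv, hA]
    decide +kernel
  · refine ⟨B * B, mul_mem mB mB, (psi_eq ?_).symm⟩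
    rw [hv, Units.val_mul, hB]
    decide +kernel
  · have hBi : (B⁻¹).val = !![(0 : ℤ), 1, 0, 0, 0; -1, 0, 1, 0, 0; -1, 0, 0, 1, 0; 0, 0, 0, 0, 1;
        -1, 0, 0, 0, 0] := by
      have h1 : B.val * !![(0 : ℤ), 1, 0, 0, 0; -1, 0, 1, 0, 0; -1, 0, 0, 1, 0; 0, 0, 0, 0, 1;
        -1, 0, 0, 0, 0] = 1 := by
        rw [hB]; decide +kernel
      exact (Units.inv_eq_of_mul_eq_one_right h1)
    refine ⟨B * A * B⁻¹, mul_mem (mul_mem mB mA) (inv_mem mB), (psi_eq ?_).symm⟩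
    rw [hv, Units.val_mul, Units.val_mul, hA, hB, hBi]
    decide +kernel

theorem finite_index (A B : GL (Fin 5) ℤ) (hA : A.val = matA) (hB : B.val = matB) :
    (Subgroup.closure {A, B}).relIndex (orthogonalSubgroup matQ) ≠ 0 := by
  set Ker := (Matrix.GeneralLinearGroup.map (n := Fin 5) (Int.castRingHom (ZMod 8))).ker with hKer
  have h1 : Ker.relIndex (orthogonalSubgroup matQ) ≠ 0 := by
    have : Ker.FiniteIndex := Subgroup.finiteIndex_ker _
    exact Subgroup.FiniteIndex.index_ne_zero
  have hK : orthogonalSubgroup matK = grp gen0 := le_antisymm le_grp grp_le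
  have h2 : ((grp gen4).map psi).relIndex ((orthogonalSubgroup matK).map psi) ≠ 0 := by
    rw [Subgroup.relIndex_map_map_of_injective _ _ psi_inj, hK]
    exact chain_index
  have h3 : (Ker ⊓ orthogonalSubgroup matQ).map phi ≤ (orthogonalSubgroup matK).map psi := by
    rintro _ ⟨P, ⟨hP, hQ⟩, rfl⟩
    obtain ⟨N, hN, e⟩ := lift_gl P hQ hP
    exact ⟨N, hN, psi_eq e⟩
  have h4 : ((Subgroup.closure {A, B}).map phi).relIndex
      ((Ker ⊓ orthogonalSubgroup matQ).map phi) ≠ 0 := by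
    intro h0
    exact h2 (Subgroup.relIndex_eq_zero_of_le_right h3
      (Subgroup.relIndex_eq_zero_of_le_left (gen4_le A B hA hB) h0))
  rw [Subgroup.relIndex_map_map_of_injective _ _ phi_inj] at h4
  refine Subgroup.relIndex_ne_zero_trans h4 ?_
  rwa [Subgroup.inf_relIndex_right]

end M5

/-- Case 2 of Theorem 1.2: the hypergeometric group `Γ(f,g)` generated by the companion matrices `A`, `B`
of `f(x) = x^5 - 2*x^4 + x^3 - x^2 + 2*x - 1` and `g(x) = x^5 + x^3 + x^2 + 1`
is an arithmetic subgroup of `O_Q(ℤ)`: it preserves `Q`, it is contained in `O_Q(ℤ)`,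
and it has finite index in `O_Q(ℤ)`. -/
theorem hypergeometric_group_arithmetic
    (A B : GL (Fin 5) ℤ)
    (hA : (A : Matrix (Fin 5) (Fin 5) ℤ) = matA)
    (hB : (B : Matrix (Fin 5) (Fin 5) ℤ) = matB) :
    matAᵀ * matQ * matA = matQ ∧
    matBᵀ * matQ * matB = matQ ∧
    Subgroup.closure {A, B} ≤ orthogonalSubgroup matQ ∧
    ((Subgroup.closure {A, B}).subgroupOf (orthogonalSubgroup matQ)).FiniteIndex := by
  have hQA : matAᵀ * matQ * matA = matQ := by decide +kernel
  have hQB : matBᵀ * matQ * matB = matQ := by decide +kernel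
  refine ⟨hQA, hQB, ?_, ⟨M5.finite_index A B hA hB⟩⟩
  rw [Subgroup.closure_le]
  rintro g (rfl | rfl)
  · change g.valᵀ * matQ * g.val = matQ
    rw [hA, hQA]
  · change g.valᵀ * matQ * g.val = matQ
    rw [hB, hQB]
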